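/- Let D be a domain in ℂ. Then D is an L²_h-domain of holomorphy if and only if for every open set U ⊂ ℂ with U \ D ≠ ∅ the set U \ D is not polar. -/

import Mathlib

open MeasureTheory Filter Metric Set

/-- `elog x` is `log x` with value `-∞` for `x ≤ 0`, as an extended real. -/
noncomputable def elog (x : ℝ) : EReal := if x ≤ 0 then ⊥ else ((Real.log x : ℝ) : EReal)

/-- The sub-mean value inequality over circles of closed discs contained in `Ω`, phrased via
continuous real-valued majorants of the (extended-real-valued) function on the circle. -/
def SubmeanOn (u : ℂ → EReal) (Ω : Set ℂ) : Prop :=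
  ∀ c : ℂ, ∀ r : ℝ, 0 < r → Metric.closedBall c r ⊆ Ω →
    ∀ φ : ℝ → ℝ, Continuous φ →
      (∀ θ : ℝ, u (c + r * Complex.exp (θ * Complex.I)) ≤ ((φ θ : ℝ) : EReal)) →
      u c ≤ (((2 * Real.pi)⁻¹ * ∫ θ in (0:ℝ)..(2 * Real.pi), φ θ : ℝ) : EReal)

/-- `u : Ω → [-∞, ∞)` is subharmonic on the open set `Ω ⊆ ℂ`: upper semicontinuous,
nowhere `+∞`, not identically `-∞` on any connected component, sub-mean value inequality. -/
def SubharmonicOn (u : ℂ → EReal) (Ω : Set ℂ) : Prop :=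
  IsOpen Ω ∧ UpperSemicontinuousOn u Ω ∧
  (∀ z ∈ Ω, u z ≠ ⊤) ∧
  (∀ z ∈ Ω, ∃ w ∈ connectedComponentIn Ω z, u w ≠ ⊥) ∧
  SubmeanOn u Ω

/-- A set `E ⊆ ℂ` is polar if some subharmonic function on an open set containing `E`
equals `-∞` on `E`. -/
def PolarSet (E : Set ℂ) : Prop :=
  ∃ Ω : Set ℂ, E ⊆ Ω ∧ ∃ u : ℂ → EReal, SubharmonicOn u Ω ∧ ∀ z ∈ E, u z = ⊥

/-- The space of square-integrable holomorphic functions on `D`. -/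
def L2h {E : Type*} [NormedAddCommGroup E] [NormedSpace ℂ E] [MeasureSpace E]
    (D : Set E) : Set (E → ℂ) :=
  {f | DifferentiableOn ℂ f D ∧ IntegrableOn (fun z => ‖f z‖ ^ 2) D volume}

/-- `D` is an `L²ₕ`-domain of holomorphy. -/
def IsL2hDomainOfHolomorphy {E : Type*} [NormedAddCommGroup E] [NormedSpace ℂ E]
    [MeasureSpace E] (D : Set E) : Prop :=
  ¬ ∃ D₀ D₁ : Set E, IsOpen D₀ ∧ IsConnected D₀ ∧ IsOpen D₁ ∧ IsConnected D₁ ∧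
      D₀ ⊆ D₁ ∩ D ∧ ¬ (D₁ ⊆ D) ∧
      ∀ f ∈ L2h D, ∃ g : E → ℂ, DifferentiableOn ℂ g D₁ ∧ Set.EqOn g f D₀

/-- The Hartogs domain `G_{D,ρ} = {(z₁,z₂) : z₁ ∈ D, |z₂| < e^{-ρ(z₁)}}`. -/
def hartogs (D : Set ℂ) (ρ : ℂ → EReal) : Set (ℂ × ℂ) :=
  {p | p.1 ∈ D ∧ elog ‖p.2‖ < - ρ p.1}

/-- `S(D)`: boundary points near which the complement of `D` is polar. -/
def polarS (D : Set ℂ) : Set ℂ :=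
  {z ∈ frontier D | ∃ U : Set ℂ, IsOpen U ∧ z ∈ U ∧ PolarSet (U \ D)}

/-- `fj` is the family of coefficients of a Hartogs expansion of `f` on `G_{D,ρ}`. -/
def HartogsExpansion (D : Set ℂ) (ρ : ℂ → EReal) (f : ℂ × ℂ → ℂ) (fj : ℕ → ℂ → ℂ) : Prop :=
  (∀ j, DifferentiableOn ℂ (fj j) D) ∧
  ∀ p ∈ hartogs D ρ, HasSum (fun j => fj j p.1 * p.2 ^ j) (f p)

/-- `ρ_f(z) = limsup_j (1/j) log |f_j(z)|` for coefficients `fj`. -/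
noncomputable def coeffGrowth (fj : ℕ → ℂ → ℂ) (z : ℂ) : EReal :=
  Filter.limsup (fun (j : ℕ) => ((((j : ℝ)⁻¹ : ℝ)) : EReal) * elog ‖fj j z‖) Filter.atTop

/-- The upper semicontinuous regularization `g*`. -/
noncomputable def uscReg (g : ℂ → EReal) (z : ℂ) : EReal := Filter.limsup g (nhds z)

/-- `ρ̃ = sup_{f ∈ L²ₕ(G_{D,ρ})} (ρ_f)*`. -/
noncomputable def rhoTilde (D : Set ℂ) (ρ : ℂ → EReal) (z : ℂ) : EReal :=
  ⨆ fj ∈ {fj : ℕ → ℂ → ℂ | ∃ f ∈ L2h (hartogs D ρ), HartogsExpansion D ρ f fj},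
    uscReg (coeffGrowth fj) z

/-- `D̂ = D ∪ {z ∈ S(D) : limsup_{D ∋ w → z} ρ(w) < ∞}`. -/
def DHat (D : Set ℂ) (ρ : ℂ → EReal) : Set ℂ :=
  D ∪ {z ∈ polarS D | Filter.limsup ρ (nhdsWithin z D) < ⊤}

open Classical in
/-- `ρ̂`, extending `ρ` to `D̂` by boundary limsups. -/
noncomputable def rhoHat (D : Set ℂ) (ρ : ℂ → EReal) (z : ℂ) : EReal :=
  if z ∈ D then ρ z else Filter.limsup ρ (nhdsWithin z D)

/-- `u` is plurisubharmonic on an open `Ω ⊆ ℂⁿ`. -/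
def PlurisubharmonicOn {n : ℕ} (u : (Fin n → ℂ) → EReal) (Ω : Set (Fin n → ℂ)) : Prop :=
  IsOpen Ω ∧ UpperSemicontinuousOn u Ω ∧
  (∀ z ∈ Ω, u z ≠ ⊤) ∧
  (∀ z ∈ Ω, ∃ w ∈ connectedComponentIn Ω z, u w ≠ ⊥) ∧
  ∀ a b : Fin n → ℂ, SubmeanOn (fun lam => u (a + lam • b)) {lam : ℂ | a + lam • b ∈ Ω}

/-- A set `E ⊆ ℂⁿ` is pluripolar. -/
def PluripolarSet {n : ℕ} (E : Set (Fin n → ℂ)) : Prop :=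
  ∃ Ω : Set (Fin n → ℂ), E ⊆ Ω ∧
    ∃ u : (Fin n → ℂ) → EReal, PlurisubharmonicOn u Ω ∧ ∀ z ∈ E, u z = ⊥

/-- `D ⊆ ℂⁿ` is pseudoconvex: it admits a plurisubharmonic exhaustion function. -/
def IsPseudoconvex {n : ℕ} (D : Set (Fin n → ℂ)) : Prop :=
  ∃ u : (Fin n → ℂ) → EReal, PlurisubharmonicOn u D ∧
    ∀ c : ℝ, IsCompact {z | z ∈ D ∧ u z ≤ (c : EReal)}

/-- `L²ₕ(D)` is infinite dimensional: arbitrarily many elements that are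
linearly independent as functions on `D`. -/
def L2hInfiniteDim {E : Type*} [NormedAddCommGroup E] [NormedSpace ℂ E] [MeasureSpace E]
    (D : Set E) : Prop :=
  ∀ N : ℕ, ∃ fs : Fin N → E → ℂ, (∀ i, fs i ∈ L2h D) ∧
    ∀ c : Fin N → ℂ, (∀ z ∈ D, ∑ i, c i * fs i z = 0) → c = 0

/-- The regularised logarithmic kernel `-log √(|z - w|² + ε²)`. -/
noncomputable def logKer (ε : ℝ) (z w : ℂ) : ℝ := -(1 / 2) * Real.log (‖z - w‖ ^ 2 + ε ^ 2)

/-- The regularised logarithmic potential of a measure on `K`. -/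
noncomputable def logPot (ε : ℝ) {K : Set ℂ} (μ : Measure K) (z : ℂ) : ℝ :=
  ∫ w : K, logKer ε z w ∂μ

lemma logKer_arg_pos {ε : ℝ} (hε : 0 < ε) (z w : ℂ) : 0 < ‖z - w‖ ^ 2 + ε ^ 2 := by positivity

lemma continuous_logKer {ε : ℝ} (hε : 0 < ε) : Continuous fun p : ℂ × ℂ => logKer ε p.1 p.2 := by
  unfold logKer
  refine continuous_const.mul (Continuous.log (by fun_prop) fun p => ?_)
  exact (logKer_arg_pos hε _ _).ne'

lemma logKer_comm (ε : ℝ) (z w : ℂ) : logKer ε z w = logKer ε w z := by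
  simp [logKer, norm_sub_rev]

lemma logKer_anti {ε ε' : ℝ} (hε : 0 < ε) (h : ε ≤ ε') (z w : ℂ) :
    logKer ε' z w ≤ logKer ε z w := by
  unfold logKer
  have : Real.log (‖z - w‖ ^ 2 + ε ^ 2) ≤ Real.log (‖z - w‖ ^ 2 + ε' ^ 2) :=
    Real.log_le_log (logKer_arg_pos hε _ _) (by gcongr)
  linarith

/-- Lower bound for the kernel on bounded sets. -/
lemma neg_log_le_logKer {ε L : ℝ} (hε : 0 < ε) {z w : ℂ} (h : ‖z - w‖ ^ 2 + ε ^ 2 ≤ L ^ 2) :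
    -Real.log L ≤ logKer ε z w := by
  have := Real.log_le_log (logKer_arg_pos hε z w) h
  rw [Real.log_pow] at this
  unfold logKer
  push_cast at this
  linarith

/-- Upper bound for the kernel away from the diagonal. -/
lemma logKer_le_neg_log {ε d : ℝ} (hd : 0 < d) {z w : ℂ} (h : d ≤ ‖z - w‖) :
    logKer ε z w ≤ -Real.log d := by
  have h2 : d ^ 2 ≤ ‖z - w‖ ^ 2 + ε ^ 2 := by nlinarith [sq_nonneg ε]
  have := Real.log_le_log (by positivity) h2
  rw [Real.log_pow] at this
  unfold logKer
  push_cast at this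
  linarith

section potential

variable {K : Set ℂ} [CompactSpace K]

lemma continuous_integrable_of_compactSpace {E : Type*} [NormedAddCommGroup E]
    (μ : Measure K) [IsFiniteMeasure μ] {f : K → E}
    (hf : Continuous f) : Integrable f μ :=
  hf.integrable_of_hasCompactSupport (HasCompactSupport.of_compactSpace f)

lemma integrable_logKer {ε : ℝ} (hε : 0 < ε) (μ : Measure K) [IsFiniteMeasure μ] (z : ℂ) :
    Integrable (fun w : K => logKer ε z w) μ :=
  continuous_integrable_of_compactSpace μ
    ((continuous_logKer hε).comp (f := fun w : K => (z, (w : ℂ))) (by fun_prop))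

lemma continuous_logPot {ε : ℝ} (hε : 0 < ε) (μ : Measure K) [IsFiniteMeasure μ] :
    Continuous (logPot ε μ) := by
  have := continuous_parametric_integral_of_continuous (μ := μ)
    (f := fun (z : ℂ) (w : K) => logKer ε z w)
    ((continuous_logKer hε).comp (f := fun p : ℂ × K => (p.1, (p.2 : ℂ))) (by fun_prop))
    isCompact_univ
  simpa only [Measure.restrict_univ] using! this

lemma logPot_anti {ε ε' : ℝ} (hε : 0 < ε) (h : ε ≤ ε') (μ : Measure K) [IsFiniteMeasure μ]
    (z : ℂ) : logPot ε' μ z ≤ logPot ε μ z :=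
  integral_mono (integrable_logKer (hε.trans_le h) μ z) (integrable_logKer hε μ z)
    fun w => logKer_anti hε h z w

lemma logPot_le_neg_log {ε d : ℝ} (hε : 0 < ε) (hd : 0 < d) (μ : Measure K)
    [IsProbabilityMeasure μ] {z : ℂ} (h : ∀ w ∈ K, d ≤ ‖z - w‖) :
    logPot ε μ z ≤ -Real.log d := by
  have := integral_mono (integrable_logKer hε μ z) (integrable_const (-Real.log d))
    fun w => logKer_le_neg_log (ε := ε) hd (h w w.2)
  simpa [logPot] using this

lemma neg_log_le_logPot {ε L : ℝ} (hε : 0 < ε) (μ : Measure K)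
    [IsProbabilityMeasure μ] {z : ℂ} (h : ∀ w ∈ K, ‖z - w‖ ^ 2 + ε ^ 2 ≤ L ^ 2) :
    -Real.log L ≤ logPot ε μ z := by
  have := integral_mono (integrable_const (-Real.log L)) (integrable_logKer hε μ z)
    fun w => neg_log_le_logKer hε (h w w.2)
  simpa [logPot] using this

lemma integral_continuous_prod {ε : ℝ} (hε : 0 < ε) :
    Continuous fun μ : ProbabilityMeasure K =>
      ∫ z : K, logPot ε (μ : Measure K) z ∂(μ : Measure K) := by
  let k : BoundedContinuousFunction (K × K) ℝ := BoundedContinuousFunction.mkOfCompact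
    ⟨fun p => logKer ε p.1 p.2, (continuous_logKer hε).comp
      (f := fun p : K × K => ((p.1 : ℂ), (p.2 : ℂ))) (by fun_prop)⟩
  have h1 := (ProbabilityMeasure.continuous_integral_boundedContinuousFunction k).comp
    ((ProbabilityMeasure.continuous_prod (α := K) (β := K)).comp
      (f := fun μ : ProbabilityMeasure K => (μ, μ)) (by fun_prop))
  refine h1.congr fun μ => ?_
  simp only [Function.comp]
  rw [ProbabilityMeasure.toMeasure_prod, integral_prod]
  · rfl
  · exact k.integrable _

lemma integral_mix (μ : Measure K) [IsProbabilityMeasure μ] (a : K) {t : ℝ} (h0 : 0 ≤ t)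
    (h1 : t ≤ 1) {f : K → ℝ} (hf : Continuous f) :
    ∫ x, f x ∂(ENNReal.ofReal (1 - t) • μ + ENNReal.ofReal t • Measure.dirac a) =
      (1 - t) * ∫ x, f x ∂μ + t * f a := by
  rw [integral_add_measure, integral_smul_measure, integral_smul_measure, integral_dirac,
    ENNReal.toReal_ofReal (by linarith), ENNReal.toReal_ofReal h0, smul_eq_mul, smul_eq_mul]
  · exact (continuous_integrable_of_compactSpace μ hf).smul_measure (by simp)
  · exact (continuous_integrable_of_compactSpace _ hf).smul_measure (by simp)

/-- Existence of an equilibrium measure for the regularised kernel. -/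
lemma exists_equilibrium [Nonempty K] {ε : ℝ} (hε : 0 < ε) :
    ∃ μ : ProbabilityMeasure K, ∀ a : K,
      ∫ z : K, logPot ε (μ : Measure K) z ∂(μ : Measure K) ≤ logPot ε (μ : Measure K) a := by
  have : Nonempty (ProbabilityMeasure K) :=
    ⟨⟨Measure.dirac (Classical.arbitrary K), inferInstance⟩⟩
  obtain ⟨μ, -, hμ⟩ := isCompact_univ.exists_isMinOn univ_nonempty
    (integral_continuous_prod (K := K) hε).continuousOn
  refine ⟨μ, fun a => ?_⟩
  set m : Measure K := (μ : Measure K)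
  set I := ∫ z : K, logPot ε m z ∂m
  set U := logPot ε m a
  have hcont : ∀ z : ℂ, Continuous fun w : K => logKer ε z w := fun z =>
    (continuous_logKer hε).comp (f := fun w : K => (z, (w : ℂ))) (by fun_prop)
  have hcont' : ∀ z : ℂ, Continuous fun w : K => logKer ε w z := fun z =>
    (continuous_logKer hε).comp (f := fun w : K => ((w : ℂ), z)) (by fun_prop)
  have key : ∀ t ∈ Ioc (0:ℝ) 1, 0 ≤ -2 * I + t * I + 2 * (1 - t) * U + t * logKer ε a a := by
    rintro t ⟨h0, h1⟩
    have hp : IsProbabilityMeasure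
        (ENNReal.ofReal (1 - t) • m + ENNReal.ofReal t • Measure.dirac a) := by
      constructor
      simp [← ENNReal.ofReal_add (sub_nonneg.2 h1) h0.le]
    have hmin : I ≤ ∫ z : K,
        logPot ε (ENNReal.ofReal (1 - t) • m + ENNReal.ofReal t • Measure.dirac a) z
        ∂(ENNReal.ofReal (1 - t) • m + ENNReal.ofReal t • Measure.dirac a) :=
      hμ (mem_univ (⟨_, hp⟩ : ProbabilityMeasure K))
    have hpot : ∀ z : ℂ, logPot ε (ENNReal.ofReal (1 - t) • m +
        ENNReal.ofReal t • Measure.dirac a) z = (1 - t) * logPot ε m z + t * logKer ε z a :=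
      fun z => integral_mix m a h0.le h1 (hcont z)
    have hc2 : Continuous fun z : K => logPot ε m z :=
      (continuous_logPot hε m).comp continuous_subtype_val
    have hIntegrable : ∫ z : K, logKer ε z a ∂m = U :=
      integral_congr_ae (Eventually.of_forall fun w => logKer_comm _ _ _)
    have hc3 := hcont' a
    simp_rw [hpot] at hmin
    rw [integral_mix m a h0.le h1
        (f := fun z => (1 - t) * logPot ε m z + t * logKer ε z a) (by fun_prop),
      integral_add ((continuous_integrable_of_compactSpace m hc2).const_mul _)
        ((continuous_integrable_of_compactSpace m (hcont' _)).const_mul _),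
      integral_const_mul, integral_const_mul, hIntegrable] at hmin
    change I ≤ (1 - t) * ((1 - t) * I + t * U) + t * ((1 - t) * U + t * logKer ε a a) at hmin
    have : 0 ≤ t * (-2 * I + t * I + 2 * (1 - t) * U + t * logKer ε a a) := by linarith
    exact nonneg_of_mul_nonneg_right this h0
  have hlim : Tendsto (fun t : ℝ => -2 * I + t * I + 2 * (1 - t) * U + t * logKer ε a a)
      (nhdsWithin 0 (Ioi 0)) (nhds (-2 * I + 0 * I + 2 * (1 - 0) * U + 0 * logKer ε a a)) :=
    (Continuous.tendsto (by fun_prop) 0).mono_left nhdsWithin_le_nhds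
  have := ge_of_tendsto hlim (by
    filter_upwards [Ioc_mem_nhdsGT (zero_lt_one' ℝ)] with t ht using key t ht)
  linarith

/-- Maximum principle for the potential of the equilibrium measure. -/
lemma logPot_le_of_equilibrium {ε : ℝ} (hε : 0 < ε) (m : Measure K) [IsProbabilityMeasure m]
    (hμ : ∀ a : K, ∫ z : K, logPot ε m z ∂m ≤ logPot ε m a) (z : ℂ) :
    logPot ε m z ≤ ∫ z : K, logPot ε m z ∂m + Real.log 2 := by
  set I := ∫ z : K, logPot ε m z ∂m
  have hc2 : Continuous fun z : K => logPot ε m z :=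
    (continuous_logPot hε m).comp continuous_subtype_val
  have hI := continuous_integrable_of_compactSpace m hc2
  have hae : ∀ᵐ w : K ∂m, logPot ε m w = I := by
    have h0 : ∫ w : K, (logPot ε m w - I) ∂m = 0 := by
      rw [integral_sub hI (integrable_const _)]; simp [I]
    have := (integral_eq_zero_iff_of_nonneg (fun w => sub_nonneg.2 (hμ w))
      (hI.sub (integrable_const _))).1 h0
    filter_upwards [this] with w hw
    simpa [sub_eq_zero] using hw
  let S : Set K := {w | logPot ε m w = I}
  have hS : IsCompact S := (isClosed_eq hc2 continuous_const).isCompact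
  have hSn : S.Nonempty := hae.exists
  obtain ⟨a, haS, ha⟩ := hS.exists_isMinOn hSn
    (f := fun w : K => ‖z - w‖) (by fun_prop)
  have hle : ∀ᵐ w : K ∂m, logKer ε z w ≤ logKer ε a w + Real.log 2 := by
    filter_upwards [hae] with w hw
    have h1 : ‖z - a‖ ≤ ‖z - w‖ := ha hw
    have h2 : ‖(a : ℂ) - w‖ ≤ 2 * ‖z - w‖ := by
      have := norm_sub_le_norm_sub_add_norm_sub (a : ℂ) z w
      rw [norm_sub_rev (a : ℂ) z] at this
      linarith
    have h3 : ‖(a : ℂ) - w‖ ^ 2 + ε ^ 2 ≤ 2 ^ 2 * (‖z - w‖ ^ 2 + ε ^ 2) := by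
      nlinarith [norm_nonneg ((a : ℂ) - w), sq_nonneg ε]
    have h4 := Real.log_le_log (logKer_arg_pos hε _ _) h3
    rw [Real.log_mul (by norm_num) (logKer_arg_pos hε _ _).ne', Real.log_pow] at h4
    unfold logKer
    push_cast at h4
    linarith
  have := integral_mono_ae (integrable_logKer hε m z)
    ((integrable_logKer hε m a).add (integrable_const (Real.log 2))) hle
  have h5 : ∫ w : K, (logKer ε a w + Real.log 2) ∂m = I + Real.log 2 := by
    rw [integral_add (integrable_logKer hε m a) (integrable_const _)]
    have : logPot ε m a = I := haS
    simp [← this, logPot]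
  exact this.trans_eq h5

/-- Either `K` carries a probability measure with bounded potential, or there are regularised
equilibrium potentials which are arbitrarily large on `K`. -/
lemma bounded_potential_or_large [Nonempty K] :
    (∃ (μ : ProbabilityMeasure K) (M : ℝ), ∀ ε > 0, ∀ z, logPot ε (μ : Measure K) z ≤ M) ∨
    (∀ V₀ : ℝ, ∃ ε ∈ Ioo (0:ℝ) 1, ∃ (μ : ProbabilityMeasure K) (V : ℝ), V₀ ≤ V ∧
      (∀ a ∈ K, V ≤ logPot ε (μ : Measure K) a) ∧
      ∫ z : K, logPot ε (μ : Measure K) z ∂(μ : Measure K) = V) := by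
  by_contra! hcon
  obtain ⟨hA, V₀, hB⟩ := hcon
  have hex : ∀ n : ℕ, ∃ μ : ProbabilityMeasure K, ∀ z,
      logPot (1 / ((n:ℝ) + 2)) (μ : Measure K) z ≤ V₀ + Real.log 2 := by
    intro n
    have hε : (0:ℝ) < 1 / ((n:ℝ) + 2) := by positivity
    have hε1 : 1 / ((n:ℝ) + 2) < 1 := by
      rw [div_lt_one (by positivity)]
      have := n.cast_nonneg (α := ℝ); linarith
    obtain ⟨μ, hμ⟩ := exists_equilibrium (K := K) hε
    refine ⟨μ, fun z => (logPot_le_of_equilibrium hε (μ : Measure K) hμ z).trans ?_⟩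
    have : ∫ z : K, logPot (1 / ((n:ℝ) + 2)) (μ : Measure K) z ∂(μ : Measure K) < V₀ := by
      by_contra! h
      exact hB _ ⟨hε, hε1⟩ μ _ h (fun a ha => hμ ⟨a, ha⟩) rfl
    linarith
  choose μs hμs using hex
  obtain ⟨μ, -, hμ⟩ := isCompact_univ.exists_mapClusterPt (f := atTop) (u := μs) (by simp)
  obtain ⟨ε, hε, z, hz⟩ := hA μ (V₀ + Real.log 2)
  refine absurd hz (not_lt.2 ?_)
  let k : BoundedContinuousFunction K ℝ := BoundedContinuousFunction.mkOfCompact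
    ⟨fun w => logKer ε z w, (continuous_logKer hε).comp
      (f := fun w : K => (z, (w : ℂ))) (by fun_prop)⟩
  have hc := ProbabilityMeasure.continuous_integral_boundedContinuousFunction k
  have hcl := hμ.continuousAt_comp hc.continuousAt
  have hev : ∀ᶠ n in atTop, ∫ w, k w ∂(μs n : Measure K) ≤ V₀ + Real.log 2 := by
    have h1 : ∀ᶠ n : ℕ in atTop, 1 / ((n:ℝ) + 2) ≤ ε := by
      obtain ⟨N, hN⟩ := exists_nat_gt (1 / ε)
      filter_upwards [eventually_ge_atTop N] with n hn
      rw [div_le_iff₀ (by positivity)]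
      rw [div_lt_iff₀ hε] at hN
      have : (N:ℝ) ≤ n := by exact_mod_cast hn
      nlinarith
    filter_upwards [h1] with n hn
    exact (logPot_anti (by positivity) hn (μs n : Measure K) z).trans (hμs n z)
  by_contra! hlt
  obtain ⟨n, hn, hn'⟩ :=
    ((MapClusterPt.frequently hcl (Ioi_mem_nhds hlt)).and_eventually hev).exists
  exact absurd hn (not_lt.2 hn')

end potential

lemma lintegral_inv_max {s ρ : ℝ} (hs : 0 < s) (hsρ : s ≤ ρ) :
    ∫⁻ r in Ioo 0 ρ, ENNReal.ofReal (max r s)⁻¹ = ENNReal.ofReal (1 + Real.log (ρ / s)) := by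
  have hcont : Continuous fun r : ℝ => (max r s)⁻¹ :=
    (continuous_id.max continuous_const).inv₀ fun r => (lt_max_of_lt_right hs).ne'
  have hρ : 0 < ρ := hs.trans_le hsρ
  rw [← ofReal_integral_eq_lintegral_ofReal]
  · congr 1
    rw [← integral_Ioc_eq_integral_Ioo, ← intervalIntegral.integral_of_le hρ.le,
      ← intervalIntegral.integral_add_adjacent_intervals (b := s)
        (hcont.intervalIntegrable _ _) (hcont.intervalIntegrable _ _)]
    congr 1
    · rw [intervalIntegral.integral_congr (g := fun _ => s⁻¹)]
      · simp [hs.ne']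
      · intro r hr
        rw [uIcc_of_le hs.le] at hr
        simp [max_eq_right hr.2]
    · rw [intervalIntegral.integral_congr (g := fun r => r⁻¹)]
      · exact integral_inv_of_pos hs hρ
      · intro r hr
        rw [uIcc_of_le hsρ] at hr
        simp [max_eq_left hr.1]
  · exact (hcont.integrableOn_Icc (a := 0) (b := ρ)).mono_set Ioo_subset_Icc_self
  · exact Eventually.of_forall fun r => inv_nonneg.2 (hs.le.trans (le_max_right _ _))

lemma lintegral_ball_polar {s ρ : ℝ} (hs : 0 < s) (hsρ : s ≤ ρ) :
    ∫⁻ z in ball (0 : ℂ) ρ, ENNReal.ofReal (‖z‖ * max ‖z‖ s)⁻¹ =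
      ENNReal.ofReal (2 * Real.pi * (1 + Real.log (ρ / s))) := by
  rw [← lintegral_indicator measurableSet_ball, ← Complex.lintegral_comp_polarCoord_symm]
  have h1 : ∀ p ∈ polarCoord.target, ENNReal.ofReal p.1 •
      (ball (0 : ℂ) ρ).indicator (fun z => ENNReal.ofReal (‖z‖ * max ‖z‖ s)⁻¹)
        (Complex.polarCoord.symm p) =
      (Ioo 0 ρ).indicator (fun r => ENNReal.ofReal (max r s)⁻¹) p.1 := by
    intro p hp
    have hp1 : 0 < p.1 := hp.1
    have hn : ‖Complex.polarCoord.symm p‖ = p.1 := by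
      rw [Complex.norm_polarCoord_symm, abs_of_pos hp1]
    by_cases h : p.1 < ρ
    · rw [indicator_of_mem (by simpa [abs_of_pos hp1] using h),
        indicator_of_mem (show p.1 ∈ Ioo 0 ρ from ⟨hp1, h⟩), hn, smul_eq_mul,
        ← ENNReal.ofReal_mul hp1.le, mul_inv, mul_inv_cancel_left₀ hp1.ne']
    · rw [indicator_of_notMem (by simpa [abs_of_pos hp1] using h),
        indicator_of_notMem (fun h' : p.1 ∈ Ioo 0 ρ => h h'.2), smul_zero]
  rw [setLIntegral_congr_fun polarCoord.open_target.measurableSet h1]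
  rw [show polarCoord.target = Ioi (0:ℝ) ×ˢ Ioo (-Real.pi) Real.pi from rfl,
    Measure.volume_eq_prod, ← Measure.prod_restrict, lintegral_prod]
  · simp only [lintegral_const, Measure.restrict_apply_univ, Real.volume_Ioo]
    rw [lintegral_mul_const' _ _ ENNReal.ofReal_ne_top, setLIntegral_indicator measurableSet_Ioo,
      inter_eq_left.2 (fun x hx => hx.1), lintegral_inv_max hs hsρ, mul_comm,
      ← ENNReal.ofReal_mul (by linarith [Real.pi_pos])]
    ring_nf
  · refine Measurable.aemeasurable ?_
    refine Measurable.comp (g := (Ioo 0 ρ).indicator fun r => ENNReal.ofReal (max r s)⁻¹)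
      ?_ measurable_fst
    exact Measurable.indicator (by fun_prop) measurableSet_Ioo

/-- The kernel `1 / √(|z - w|² + ε²)`. -/
noncomputable def invKer (ε : ℝ) (z w : ℂ) : ℝ := (√(‖z - w‖ ^ 2 + ε ^ 2))⁻¹

lemma invKer_nonneg (ε : ℝ) (z w : ℂ) : 0 ≤ invKer ε z w := by unfold invKer; positivity

lemma continuous_invKer {ε : ℝ} (hε : 0 < ε) : Continuous fun p : ℂ × ℂ => invKer ε p.1 p.2 := by
  unfold invKer
  exact Continuous.inv₀ (by fun_prop) fun p => (Real.sqrt_pos.2 (logKer_arg_pos hε _ _)).ne'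

lemma invKer_mul_le {ε : ℝ} (hε : 0 < ε) {z w w' : ℂ} (h : ‖z - w‖ ≤ ‖z - w'‖) (hz : z ≠ w) :
    invKer ε z w * invKer ε z w' ≤ (‖z - w‖ * max ‖z - w‖ (max (‖w - w'‖ / 2) ε))⁻¹ := by
  unfold invKer
  rw [← mul_inv]
  have h0 : 0 < ‖z - w‖ := norm_pos_iff.2 (sub_ne_zero.2 hz)
  have hd : ‖w - w'‖ ≤ ‖z - w‖ + ‖z - w'‖ := by
    have := norm_sub_le_norm_sub_add_norm_sub w z w'
    rwa [norm_sub_rev w z] at this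
  apply inv_anti₀ (by positivity)
  gcongr
  · exact Real.le_sqrt_of_sq_le (by nlinarith)
  · refine max_le (Real.le_sqrt_of_sq_le ?_) (max_le (Real.le_sqrt_of_sq_le ?_)
      (Real.le_sqrt_of_sq_le ?_))
    · nlinarith
    · nlinarith [norm_nonneg (w - w')]
    · nlinarith [norm_nonneg (z - w')]

lemma setLIntegral_translate_le {c w : ℂ} {R ρ : ℝ} (hw : w ∈ ball c R) (hρ : 2 * R ≤ ρ)
    (g : ℂ → ENNReal) :
    ∫⁻ z in ball c R, g (z - w) ≤ ∫⁻ z in ball (0 : ℂ) ρ, g z := by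
  rw [← lintegral_indicator measurableSet_ball, ← lintegral_indicator measurableSet_ball,
    ← lintegral_sub_right_eq_self ((ball (0 : ℂ) ρ).indicator g) w]
  refine lintegral_mono fun z => ?_
  by_cases hz : z ∈ ball c R
  · rw [indicator_of_mem hz, indicator_of_mem]
    rw [mem_ball_zero_iff]
    have := dist_triangle_right z w c
    rw [mem_ball] at hz hw
    rw [← dist_eq_norm]
    linarith
  · simp [indicator_of_notMem hz]

/-- The constant in the energy estimate. -/
noncomputable def energyConst (R : ℝ) : ℝ :=
  4 * Real.pi * (1 + Real.log (2 * R + 1) + 1 / 2 * Real.log 8)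

lemma lintegral_invKer_mul_le {c w w' : ℂ} {R ε : ℝ} (hε : 0 < ε) (hε1 : ε ≤ 1)
    (hw : w ∈ ball c R) (hw' : w' ∈ ball c R) :
    0 ≤ energyConst R + 4 * Real.pi * logKer ε w w' ∧
    ∫⁻ z in ball c R, ENNReal.ofReal (invKer ε z w * invKer ε z w') ≤
      ENNReal.ofReal (energyConst R + 4 * Real.pi * logKer ε w w') := by
  set s := max (‖w - w'‖ / 2) ε
  have hs : 0 < s := lt_max_of_lt_right hε
  have hR : 0 < R := pos_of_mem_ball hw
  have hd : ‖w - w'‖ < 2 * R := by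
    have := dist_triangle_right w w' c
    rw [mem_ball] at hw hw'
    rw [← dist_eq_norm]; linarith
  have hsρ : s ≤ 2 * R + 1 := max_le (by linarith [norm_nonneg (w - w')]) (by linarith)
  have hlog : 1 + Real.log ((2 * R + 1) / s) ≤
      1 + Real.log (2 * R + 1) + 1 / 2 * Real.log 8 + logKer ε w w' := by
    rw [Real.log_div (by positivity) hs.ne']
    have h1 : ‖w - w'‖ ^ 2 + ε ^ 2 ≤ 8 * s ^ 2 := by
      have ha : ‖w - w'‖ / 2 ≤ s := le_max_left _ _
      have hb : ε ≤ s := le_max_right _ _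
      nlinarith [norm_nonneg (w - w')]
    have h2 := Real.log_le_log (logKer_arg_pos hε _ _) h1
    rw [Real.log_mul (by norm_num) (by positivity), Real.log_pow] at h2
    push_cast at h2
    unfold logKer
    linarith
  have hlog0 : 0 ≤ Real.log ((2 * R + 1) / s) := Real.log_nonneg (by rwa [one_le_div hs])
  have hfin : 2 * Real.pi * (1 + Real.log ((2 * R + 1) / s)) +
      2 * Real.pi * (1 + Real.log ((2 * R + 1) / s)) ≤
      energyConst R + 4 * Real.pi * logKer ε w w' := by
    unfold energyConst
    nlinarith [Real.pi_pos]
  have hpos : 0 ≤ 2 * Real.pi * (1 + Real.log ((2 * R + 1) / s)) := by positivity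
  refine ⟨le_trans (by positivity) hfin, ?_⟩
  set g : ℂ → ENNReal := fun z => ENNReal.ofReal (‖z‖ * max ‖z‖ s)⁻¹
  have hg : Measurable g := by fun_prop
  calc ∫⁻ z in ball c R, ENNReal.ofReal (invKer ε z w * invKer ε z w')
      ≤ ∫⁻ z in ball c R, (g (z - w) + g (z - w')) := by
        refine lintegral_mono_ae (ae_restrict_of_ae ?_)
        have hne : ∀ a : ℂ, ∀ᵐ z : ℂ, z ≠ a := fun a => by
          simp [ae_iff]
        filter_upwards [hne w, hne w'] with z hz hz'
        rcases le_total ‖z - w‖ ‖z - w'‖ with h | h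
        · exact (ENNReal.ofReal_le_ofReal (invKer_mul_le hε h hz)).trans le_self_add
        · refine (ENNReal.ofReal_le_ofReal ?_).trans le_add_self
          have := invKer_mul_le hε h hz'
          rwa [mul_comm, norm_sub_rev w'] at this
    _ = (∫⁻ z in ball c R, g (z - w)) + ∫⁻ z in ball c R, g (z - w') :=
        lintegral_add_left (by fun_prop) _
    _ ≤ (∫⁻ z in ball (0:ℂ) (2 * R + 1), g z) + ∫⁻ z in ball (0:ℂ) (2 * R + 1), g z :=
        add_le_add (setLIntegral_translate_le hw (by linarith) g)
          (setLIntegral_translate_le hw' (by linarith) g)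
    _ ≤ _ := by
        rw [lintegral_ball_polar hs hsρ, ← ENNReal.ofReal_add hpos hpos]
        exact ENNReal.ofReal_le_ofReal hfin

/-- The energy estimate: the `L²` norm of `∫ dμ(w) / |z - w|` is controlled by the logarithmic
energy of `μ`. -/
lemma lintegral_sq_invKer_le {K : Set ℂ} [CompactSpace K] (μ : Measure K) [IsProbabilityMeasure μ]
    {c : ℂ} {R ε : ℝ} (hε : 0 < ε) (hε1 : ε ≤ 1) (hK : K ⊆ ball c R) :
    ∫⁻ z in ball c R, (∫⁻ w : K, ENNReal.ofReal (invKer ε z w) ∂μ) ^ 2 ≤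
      ENNReal.ofReal (energyConst R + 4 * Real.pi * ∫ z : K, logPot ε μ z ∂μ) := by
  have hm : Measurable fun p : ℂ × ℂ => ENNReal.ofReal (invKer ε p.1 p.2) :=
    (continuous_invKer hε).measurable.ennreal_ofReal
  have hk : Continuous fun p : K × K => energyConst R + 4 * Real.pi * logKer ε p.1 p.2 :=
    continuous_const.add (continuous_const.mul ((continuous_logKer hε).comp
      (f := fun p : K × K => ((p.1 : ℂ), (p.2 : ℂ))) (by fun_prop)))
  have hmz : ∀ z : ℂ, Measurable fun w : K => ENNReal.ofReal (invKer ε z w) := fun z =>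
    hm.comp (f := fun w : K => (z, (w : ℂ))) (by fun_prop)
  calc ∫⁻ z in ball c R, (∫⁻ w : K, ENNReal.ofReal (invKer ε z w) ∂μ) ^ 2
      = ∫⁻ z in ball c R, ∫⁻ p : K × K,
          ENNReal.ofReal (invKer ε z p.1 * invKer ε z p.2) ∂(μ.prod μ) := by
        refine lintegral_congr fun z => ?_
        rw [sq, ← lintegral_prod_mul (hmz z).aemeasurable (hmz z).aemeasurable]
        refine lintegral_congr fun p => ?_
        rw [ENNReal.ofReal_mul (invKer_nonneg _ _ _)]
    _ = ∫⁻ p : K × K, (∫⁻ z in ball c R,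
          ENNReal.ofReal (invKer ε z p.1 * invKer ε z p.2)) ∂(μ.prod μ) := by
        refine lintegral_lintegral_swap (Measurable.aemeasurable ?_)
        have h1 : Measurable fun q : ℂ × (K × K) => invKer ε q.1 q.2.1 :=
          (continuous_invKer hε).measurable.comp
            (f := fun q : ℂ × (K × K) => (q.1, (q.2.1 : ℂ))) (by fun_prop)
        have h2 : Measurable fun q : ℂ × (K × K) => invKer ε q.1 q.2.2 :=
          (continuous_invKer hε).measurable.comp
            (f := fun q : ℂ × (K × K) => (q.1, (q.2.2 : ℂ))) (by fun_prop)
        exact (h1.mul h2).ennreal_ofReal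
    _ ≤ ∫⁻ p : K × K, ENNReal.ofReal (energyConst R + 4 * Real.pi * logKer ε p.1 p.2)
          ∂(μ.prod μ) :=
        lintegral_mono fun p => (lintegral_invKer_mul_le hε hε1 (hK p.1.2) (hK p.2.2)).2
    _ = ENNReal.ofReal (∫ p : K × K, (energyConst R + 4 * Real.pi * logKer ε p.1 p.2)
          ∂(μ.prod μ)) := by
        rw [ofReal_integral_eq_lintegral_ofReal
          (hk.integrable_of_hasCompactSupport (HasCompactSupport.of_compactSpace _))
          (Eventually.of_forall fun p =>
            (lintegral_invKer_mul_le hε hε1 (hK p.1.2) (hK p.2.2)).1)]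
    _ = _ := by
        congr 1
        have hk' : Continuous fun p : K × K => logKer ε p.1 p.2 :=
          (continuous_logKer hε).comp
            (f := fun p : K × K => ((p.1 : ℂ), (p.2 : ℂ))) (by fun_prop)
        have hi := hk'.integrable_of_hasCompactSupport (μ := μ.prod μ)
          (HasCompactSupport.of_compactSpace _)
        rw [integral_add (integrable_const _) (hi.const_mul _), integral_const_mul,
          integral_prod _ hi]
        simp [logPot]

lemma hasDerivAt_cauchyIntegral {α : Type*} [MeasurableSpace α] {ν : Measure α} {m φ : α → ℂ}
    (hm : Integrable m ν) (hφ : Measurable φ) {z₀ : ℂ} {δ : ℝ} (hδ : 0 < δ)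
    (h : ∀ᵐ a ∂ν, m a = 0 ∨ δ ≤ ‖φ a - z₀‖) (k : ℕ) :
    HasDerivAt (fun z => ∫ a, m a * ((φ a - z) ^ (k + 1))⁻¹ ∂ν)
      (∫ a, m a * ((k + 1) * ((φ a - z₀) ^ (k + 2))⁻¹) ∂ν) z₀ := by
  have hmeas : ∀ (j : ℕ) (z : ℂ), AEStronglyMeasurable (fun a => ((φ a - z) ^ j)⁻¹) ν :=
    fun j z => ((hφ.sub_const z).pow_const j).inv.aestronglyMeasurable
  have hlow : ∀ a, δ ≤ ‖φ a - z₀‖ → ∀ z ∈ ball z₀ (δ / 2), δ / 2 ≤ ‖φ a - z‖ := by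
    intro a ha z hz
    have h1 := norm_sub_le_norm_sub_add_norm_sub (φ a) z z₀
    rw [mem_ball, dist_eq_norm] at hz
    linarith
  have hbd : ∀ (j : ℕ) (x : ℂ), δ / 2 ≤ ‖x‖ → ‖(x ^ j)⁻¹‖ ≤ ((δ / 2) ^ j)⁻¹ := by
    intro j x hx
    rw [norm_inv, norm_pow]
    gcongr
  refine (hasDerivAt_integral_of_dominated_loc_of_deriv_le
    (F' := fun z a => m a * ((k + 1) * ((φ a - z) ^ (k + 2))⁻¹))
    (bound := fun a => ‖m a‖ * ((k + 1) * ((δ / 2) ^ (k + 2))⁻¹))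
    (ball_mem_nhds z₀ (half_pos hδ)) (Eventually.of_forall fun z => hm.1.mul (hmeas _ z)) ?_
    (hm.1.mul ((hmeas _ z₀).const_mul _)) ?_ (hm.norm.mul_const _) ?_).2
  · refine (hm.norm.mul_const ((δ / 2) ^ (k + 1))⁻¹).mono' (hm.1.mul (hmeas _ z₀)) ?_
    filter_upwards [h] with a ha
    rcases ha with ha | ha
    · simp [ha]
    · rw [Pi.mul_apply, norm_mul]
      gcongr
      exact hbd _ _ (hlow a ha z₀ (mem_ball_self (half_pos hδ)))
  · filter_upwards [h] with a ha z hz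
    rcases ha with ha | ha
    · simp [ha]
    · rw [norm_mul, norm_mul]
      gcongr
      · exact_mod_cast (Complex.norm_natCast (k + 1)).le
      · exact hbd _ _ (hlow a ha z hz)
  · filter_upwards [h] with a ha z hz
    rcases ha with ha | ha
    · simpa [ha] using hasDerivAt_const z (0 : ℂ)
    · have hne : φ a - z ≠ 0 := norm_pos_iff.1 ((half_pos hδ).trans_le (hlow a ha z hz))
      have h1 := (((hasDerivAt_id z).const_sub (φ a)).pow (k + 1)).inv (pow_ne_zero _ hne)
      refine (h1.const_mul (m a)).congr_deriv ?_
      simp only [id]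
      field_simp
      push_cast
      simp
      ring

lemma differentiableOn_cauchyIntegral {α : Type*} [MeasurableSpace α] {ν : Measure α}
    {m φ : α → ℂ} (hm : Integrable m ν) (hφ : Measurable φ) {O : Set ℂ}
    (h : ∀ z ∈ O, ∃ δ > 0, ∀ᵐ a ∂ν, m a = 0 ∨ δ ≤ ‖φ a - z‖) :
    DifferentiableOn ℂ (fun z => ∫ a, m a * (φ a - z)⁻¹ ∂ν) O := by
  intro z hz
  obtain ⟨δ, hδ, h'⟩ := h z hz
  simpa using (hasDerivAt_cauchyIntegral hm hφ hδ h' 0).differentiableAt.differentiableWithinAt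

lemma iteratedDeriv_cauchyIntegral {α : Type*} [MeasurableSpace α] {ν : Measure α}
    {m φ : α → ℂ} (hm : Integrable m ν) (hφ : Measurable φ) {O : Set ℂ} (hO : IsOpen O)
    (h : ∀ z ∈ O, ∃ δ > 0, ∀ᵐ a ∂ν, m a = 0 ∨ δ ≤ ‖φ a - z‖) (n : ℕ) :
    EqOn (iteratedDeriv n fun z => ∫ a, m a * (φ a - z)⁻¹ ∂ν)
      (fun z => n.factorial * ∫ a, m a * ((φ a - z) ^ (n + 1))⁻¹ ∂ν) O := by
  induction n with
  | zero => intro z _; simp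
  | succ n ih =>
    intro z hz
    obtain ⟨δ, hδ, h'⟩ := h z hz
    rw [iteratedDeriv_succ, (ih.eventuallyEq_of_mem (hO.mem_nhds hz)).deriv_eq,
      ((hasDerivAt_cauchyIntegral hm hφ hδ h' n).const_mul _).deriv, Nat.factorial_succ]
    simp_rw [mul_left_comm (m _)]
    rw [integral_const_mul]
    push_cast
    ring

lemma logKer_hasFDerivAt {ε : ℝ} (hε : 0 < ε) (w z : ℂ) :
    HasFDerivAt (fun z => logKer ε z w)
      (-((‖z - w‖ ^ 2 + ε ^ 2)⁻¹ • innerSL ℝ (z - w))) z := by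
  unfold logKer
  have h1 : HasFDerivAt (fun z : ℂ => ‖z - w‖ ^ 2 + ε ^ 2) (2 • innerSL ℝ (z - w)) z := by
    simpa using! ((hasFDerivAt_id z).sub_const w).norm_sq.add_const (ε ^ 2)
  have h2 := (h1.log (logKer_arg_pos hε z w).ne').const_mul (-(1 / 2))
  refine h2.congr_fderiv ?_
  ext
  simp
  ring

/-- The derivative of `logPot`. -/
noncomputable def logPotDeriv {K : Set ℂ} (ε : ℝ) (μ : Measure K) (z : ℂ) : ℂ →L[ℝ] ℝ :=
  ∫ w : K, -((‖z - w‖ ^ 2 + ε ^ 2)⁻¹ • innerSL ℝ (z - (w : ℂ))) ∂μ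

lemma norm_logKerDeriv_le {ε : ℝ} (hε : 0 < ε) (z w : ℂ) :
    ‖-((‖z - w‖ ^ 2 + ε ^ 2)⁻¹ • innerSL ℝ (z - w))‖ ≤ invKer ε z w := by
  rw [norm_neg, norm_smul, innerSL_apply_norm, norm_inv,
    Real.norm_of_nonneg (logKer_arg_pos hε z w).le, invKer]
  set A := ‖z - w‖ ^ 2 + ε ^ 2 with hA
  have hA0 : 0 < A := logKer_arg_pos hε z w
  have h1 : ‖z - w‖ ≤ √A := Real.le_sqrt_of_sq_le (by nlinarith)
  have h2 : √A * √A = A := Real.mul_self_sqrt hA0.le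
  have h3 : 0 < √A := Real.sqrt_pos.2 hA0
  calc A⁻¹ * ‖z - w‖ ≤ A⁻¹ * √A := by gcongr
    _ = (√A)⁻¹ := by
        rw [inv_mul_eq_iff_eq_mul₀ hA0.ne', ← div_eq_mul_inv, eq_div_iff h3.ne', h2]

lemma invKer_le {ε : ℝ} (hε : 0 < ε) (z w : ℂ) : invKer ε z w ≤ ε⁻¹ := by
  unfold invKer
  apply inv_anti₀ hε
  exact Real.le_sqrt_of_sq_le (by nlinarith [norm_nonneg (z - w)])

lemma continuous_logKerDeriv {ε : ℝ} (hε : 0 < ε) : Continuous fun p : ℂ × ℂ =>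
    -((‖p.1 - p.2‖ ^ 2 + ε ^ 2)⁻¹ • innerSL ℝ (p.1 - p.2)) := by
  refine Continuous.neg (Continuous.smul (Continuous.inv₀ (by fun_prop)
    fun p => (logKer_arg_pos hε _ _).ne') ?_)
  exact (innerSL ℝ).continuous.comp (by fun_prop : Continuous fun p : ℂ × ℂ => p.1 - p.2)

lemma logPot_hasFDerivAt {K : Set ℂ} [CompactSpace K] (μ : Measure K) [IsFiniteMeasure μ]
    {ε : ℝ} (hε : 0 < ε) (z : ℂ) : HasFDerivAt (logPot ε μ) (logPotDeriv ε μ z) z := by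
  have hc : ∀ z : ℂ, Continuous fun w : K =>
      -((‖z - w‖ ^ 2 + ε ^ 2)⁻¹ • innerSL ℝ (z - (w : ℂ))) := fun z =>
    (continuous_logKerDeriv hε).comp (f := fun w : K => (z, (w : ℂ))) (by fun_prop)
  refine hasFDerivAt_integral_of_dominated_of_fderiv_le (bound := fun _ => ε⁻¹)
    (F' := fun (z : ℂ) (w : K) => -((‖z - w‖ ^ 2 + ε ^ 2)⁻¹ • innerSL ℝ (z - (w : ℂ))))
    (s := univ) univ_mem
    (Eventually.of_forall fun z => (integrable_logKer hε μ z).1) (integrable_logKer hε μ z)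
    (hc z).aestronglyMeasurable_of_compactSpace ?_ (integrable_const _) ?_
  · exact Eventually.of_forall fun w z _ => (norm_logKerDeriv_le hε z w).trans (invKer_le hε z w)
  · exact Eventually.of_forall fun w z _ => logKer_hasFDerivAt hε w z

lemma continuous_logPotDeriv {K : Set ℂ} [CompactSpace K] (μ : Measure K) [IsFiniteMeasure μ]
    {ε : ℝ} (hε : 0 < ε) : Continuous (logPotDeriv ε μ) := by
  unfold logPotDeriv
  have := continuous_parametric_integral_of_continuous (μ := μ) (s := univ) (f := fun (z : ℂ)
    (w : K) => -((‖z - w‖ ^ 2 + ε ^ 2)⁻¹ • innerSL ℝ (z - (w : ℂ)))) ?_ isCompact_univ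
  · simpa using this
  · exact (continuous_logKerDeriv hε).comp (f := fun p : ℂ × K => (p.1, (p.2 : ℂ))) (by fun_prop)

lemma continuous_integral_invKer {K : Set ℂ} [CompactSpace K] (μ : Measure K) [IsFiniteMeasure μ]
    {ε : ℝ} (hε : 0 < ε) : Continuous fun z : ℂ => ∫ w : K, invKer ε z w ∂μ := by
  have := continuous_parametric_integral_of_continuous (μ := μ) (s := univ) (f := fun (z : ℂ)
    (w : K) => invKer ε z w) ?_ isCompact_univ
  · simpa using this
  · exact (continuous_invKer hε).comp (f := fun p : ℂ × K => (p.1, (p.2 : ℂ))) (by fun_prop)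

lemma integrable_invKer {K : Set ℂ} [CompactSpace K] (μ : Measure K) [IsFiniteMeasure μ]
    {ε : ℝ} (hε : 0 < ε) (z : ℂ) : Integrable (fun w : K => invKer ε z w) μ :=
  continuous_integrable_of_compactSpace μ
    ((continuous_invKer hε).comp (f := fun w : K => (z, (w : ℂ))) (by fun_prop))

lemma norm_logPotDeriv_le {K : Set ℂ} [CompactSpace K] (μ : Measure K) [IsFiniteMeasure μ]
    {ε : ℝ} (hε : 0 < ε) (z : ℂ) : ‖logPotDeriv ε μ z‖ ≤ ∫ w : K, invKer ε z w ∂μ :=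
  norm_integral_le_of_norm_le (integrable_invKer μ hε z)
    (Eventually.of_forall fun w => norm_logKerDeriv_le hε z w)

lemma circleAverage_integral {K : Set ℂ} [CompactSpace K] (μ : Measure K) [IsFiniteMeasure μ]
    {c : ℂ} {r : ℝ} {k : ℂ → ℂ → ℝ}
    (hk : Continuous fun p : ℝ × K => k (circleMap c r p.1) p.2) :
    Real.circleAverage (fun z => ∫ w : K, k z w ∂μ) c r =
      ∫ w : K, Real.circleAverage (fun z => k z w) c r ∂μ := by
  unfold Real.circleAverage
  simp only [smul_eq_mul]
  rw [intervalIntegral_integral_swap, integral_const_mul]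
  rw [← Measure.restrict_univ (μ := μ), Measure.prod_restrict]
  refine IntegrableOn.mono_set (t := Icc 0 (2 * Real.pi) ×ˢ (univ : Set K))
    (hk.continuousOn.integrableOn_compact (isCompact_Icc.prod isCompact_univ)) ?_
  rw [uIoc_of_le Real.two_pi_pos.le]
  exact prod_mono Ioc_subset_Icc_self subset_rfl

lemma submean_circleAverage {u : ℂ → EReal} {Ω : Set ℂ} (hu : SubmeanOn u Ω) {c : ℂ} {r : ℝ}
    (hr : 0 < r) (hΩ : closedBall c r ⊆ Ω) {φ : ℂ → ℝ}
    (hφ : Continuous fun θ : ℝ => φ (circleMap c r θ))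
    (h : ∀ z ∈ sphere c r, u z ≤ φ z) : u c ≤ (Real.circleAverage φ c r : ℝ) := by
  refine hu c r hr hΩ (fun θ => φ (circleMap c r θ)) hφ fun θ => ?_
  exact h (circleMap c r θ) (circleMap_mem_sphere c hr.le θ)

lemma exists_real_bound {u : ℂ → EReal} {Ω S : Set ℂ} (hu : UpperSemicontinuousOn u Ω)
    (htop : ∀ z ∈ Ω, u z ≠ ⊤) (hS : IsCompact S) (hSΩ : S ⊆ Ω) :
    ∃ B : ℝ, ∀ z ∈ S, u z ≤ B := by
  rcases S.eq_empty_or_nonempty with rfl | hne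
  · exact ⟨0, by simp⟩
  obtain ⟨a, ha, hmax⟩ := (hu.mono hSΩ).exists_isMaxOn hne hS
  obtain ⟨B, hB, -⟩ := EReal.lt_iff_exists_real_btwn.1 (lt_top_iff_ne_top.2 (htop a (hSΩ ha)))
  exact ⟨B, fun z hz => (hmax hz).trans hB.le⟩

lemma bot_of_circle_meets {u : ℂ → EReal} {Ω : Set ℂ} (hu : SubharmonicOn u Ω) {c z₁ : ℂ} {r t : ℝ}
    (hr : 0 < r) (hΩ : closedBall c r ⊆ Ω) (hz₁ : z₁ ∈ sphere c r) (ht : 0 < t)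
    (h : ∀ z ∈ ball z₁ t, u z = ⊥) : u c = ⊥ := by
  obtain ⟨-, husc, htop, -, hsub⟩ := hu
  obtain ⟨B, hB⟩ := exists_real_bound husc htop (isCompact_closedBall c r) hΩ
  set f : ℂ → ℝ := fun z => max 0 (t - ‖z - z₁‖) with hf
  have hfc : Continuous fun θ : ℝ => f (circleMap c r θ) := by
    have := continuous_circleMap c r
    fun_prop
  set A := Real.circleAverage f c r with hA
  have hApos : 0 < A := by
    rw [hA, Real.circleAverage, smul_eq_mul]
    refine mul_pos (by positivity) (intervalIntegral.integral_pos Real.two_pi_pos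
      hfc.continuousOn (fun θ _ => le_max_left _ _) ?_)
    have : z₁ ∈ circleMap c r '' Ioc 0 (2 * Real.pi) := by
      rwa [image_circleMap_Ioc, abs_of_pos hr] 
    obtain ⟨θ, hθ, rfl⟩ := this
    exact ⟨θ, Ioc_subset_Icc_self hθ, by simp [hf, ht]⟩
  have key : ∀ n : ℕ, u c ≤ ((B - n * A : ℝ) : EReal) := by
    intro n
    have h1 := submean_circleAverage (φ := fun z => B - n * f z) hsub hr hΩ (by fun_prop) ?_
    · convert h1 using 2
      have hi : CircleIntegrable f c r := (hfc.intervalIntegrable _ _)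
      have h2 : (fun z => B - n * f z) = (fun _ => B) - (n : ℝ) • f := by
        ext z; simp
      rw [h2, Real.circleAverage_sub (circleIntegrable_const _ _ _) (hi.const_smul),
        Real.circleAverage_const, Real.circleAverage_smul, smul_eq_mul]
    · intro z hz
      by_cases hz1 : z ∈ ball z₁ t
      · simp [h z hz1]
      · rw [mem_ball, dist_eq_norm, not_lt] at hz1
        have : f z = 0 := max_eq_left (by linarith)
        simpa [this] using hB z (sphere_subset_closedBall hz)
  refine EReal.eq_bot_iff_forall_lt _ |>.2 fun y => ?_
  obtain ⟨n, hn⟩ := exists_nat_gt ((B - y) / A)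
  refine (key n).trans_lt (EReal.coe_lt_coe_iff.2 ?_)
  rw [div_lt_iff₀ hApos] at hn
  linarith

lemma exists_ne_bot_of_subharmonicOn {u : ℂ → EReal} {Ω : Set ℂ} (hu : SubharmonicOn u Ω)
    {z₀ : ℂ} {s : ℝ} (hs : 0 < s) (hΩ : ball z₀ s ⊆ Ω) : ∃ z ∈ ball z₀ s, u z ≠ ⊥ := by
  by_contra! hbot
  set I := interior {z | z ∈ Ω ∧ u z = ⊥} with hI
  have hz₀ : z₀ ∈ Ω := hΩ (mem_ball_self hs)
  have hz₀I : z₀ ∈ I := mem_interior.2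
    ⟨ball z₀ s, fun z hz => ⟨hΩ hz, hbot z hz⟩, isOpen_ball, mem_ball_self hs⟩
  have hcl : ∀ z ∈ Ω, z ∈ closure I → z ∈ I := by
    intro z hz hzI
    obtain ⟨s', hs', hsΩ⟩ := Metric.isOpen_iff.1 hu.1 z hz
    refine mem_interior.2 ⟨ball z (s' / 4), fun c hc => ?_, isOpen_ball,
      mem_ball_self (by positivity)⟩
    have hcΩ : c ∈ Ω := hsΩ (ball_subset_ball (by linarith) hc)
    refine ⟨hcΩ, ?_⟩
    obtain ⟨z₁, hz₁I, hz₁⟩ := Metric.mem_closure_iff.1 hzI (s' / 4) (by positivity)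
    obtain ⟨t, ht, htI⟩ := Metric.isOpen_iff.1 isOpen_interior z₁ hz₁I
    by_cases hc1 : c = z₁
    · exact hc1 ▸ (interior_subset hz₁I).2
    · rw [mem_ball] at hc
      have hd := dist_triangle c z z₁
      refine bot_of_circle_meets hu (r := dist z₁ c) (dist_pos.2 (Ne.symm hc1)) ?_ rfl ht
        fun z' hz' => (interior_subset (htI hz')).2
      refine fun x hx => hsΩ ?_
      rw [mem_closedBall, dist_comm z₁ c] at hx
      have := dist_triangle x c z
      rw [mem_ball]
      linarith
  obtain ⟨w, hw, hwu⟩ := hu.2.2.2.1 z₀ hz₀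
  have hsub := isPreconnected_connectedComponentIn.subset_of_closure_inter_subset
    (s := connectedComponentIn Ω z₀) isOpen_interior
    ⟨z₀, mem_connectedComponentIn hz₀, hz₀I⟩
    fun z hz => hcl z (connectedComponentIn_subset _ _ hz.2) hz.1
  exact hwu (interior_subset (hsub hw)).2

/-- The logarithmic potential `∫ log |z - w| dμ(w)`. -/
noncomputable def logInt {K : Set ℂ} (μ : Measure K) (z : ℂ) : ℝ := ∫ w : K, Real.log ‖z - w‖ ∂μ

lemma continuous_log_norm_sub {K : Set ℂ} {X : Type*} [TopologicalSpace X] {f : X → ℂ}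
    (hf : Continuous f) (h : ∀ x, f x ∉ K) :
    Continuous fun p : X × K => Real.log ‖f p.1 - p.2‖ := by
  refine Continuous.log (by fun_prop) fun p hp => ?_
  rw [norm_eq_zero, sub_eq_zero] at hp
  exact h p.1 (hp ▸ p.2.2)

lemma integrable_log_norm_sub {K : Set ℂ} [CompactSpace K] (μ : Measure K) [IsFiniteMeasure μ]
    {z : ℂ} (hz : z ∉ K) : Integrable (fun w : K => Real.log ‖z - w‖) μ :=
  continuous_integrable_of_compactSpace μ
    ((continuous_log_norm_sub (X := Unit) (f := fun _ => z) continuous_const fun _ => hz).comp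
      (f := fun w : K => ((), w)) (by fun_prop))

lemma isClosed_of_compactSpace (K : Set ℂ) [CompactSpace K] : IsClosed K :=
  (isCompact_iff_compactSpace.2 inferInstance).isClosed

lemma neg_logInt_le {K : Set ℂ} [CompactSpace K] (μ : Measure K) [IsProbabilityMeasure μ] {M : ℝ}
    (hM : ∀ ε > 0, ∀ z, logPot ε μ z ≤ M) {z : ℂ} (hz : z ∉ K) : -logInt μ z ≤ M := by
  obtain ⟨d, hd, hdK⟩ := Metric.isOpen_iff.1 (isClosed_of_compactSpace K).isOpen_compl z hz
  have hdw : ∀ w ∈ K, d ≤ ‖z - w‖ := fun w hw => by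
    by_contra! h
    exact hdK (by rwa [mem_ball, dist_comm, dist_eq_norm]) hw
  refine le_of_forall_pos_le_add fun e he => ?_
  obtain ⟨ε, hε, hεe⟩ : ∃ ε > 0, ε ^ 2 / (2 * d ^ 2) ≤ e := by
    refine ⟨√(e * (2 * d ^ 2)), by positivity, ?_⟩
    rw [Real.sq_sqrt (by positivity), mul_div_cancel_right₀ _ (by positivity)]
  have hpt : ∀ w : K, -Real.log ‖z - w‖ ≤ logKer ε z w + e := by
    intro w
    have hw := hdw w w.2
    have hw0 : 0 < ‖z - w‖ := hd.trans_le hw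
    have h1 : Real.log (‖z - w‖ ^ 2 + ε ^ 2) = 2 * Real.log ‖z - w‖ +
        Real.log (1 + ε ^ 2 / ‖z - w‖ ^ 2) := by
      have h1 := Real.log_pow (n := 2) (x := ‖z - w‖)
      push_cast at h1
      rw [← h1, ← Real.log_mul (by positivity) (by positivity)]
      congr 1
      field_simp
    have h2 : Real.log (1 + ε ^ 2 / ‖z - w‖ ^ 2) ≤ ε ^ 2 / d ^ 2 := by
      refine (Real.log_le_sub_one_of_pos (by positivity)).trans ?_
      rw [add_sub_cancel_left]
      gcongr
    have h3 : ε ^ 2 / (2 * d ^ 2) = ε ^ 2 / d ^ 2 / 2 := by field_simp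
    unfold logKer
    linarith
  have hi := integrable_logKer hε μ z
  calc -logInt μ z = ∫ w : K, -Real.log ‖z - w‖ ∂μ := (integral_neg _).symm
    _ ≤ ∫ w : K, (logKer ε z w + e) ∂μ :=
        integral_mono (integrable_log_norm_sub μ hz).neg (hi.add (integrable_const e)) hpt
    _ = logPot ε μ z + e := by rw [integral_add hi (integrable_const e)]; simp [logPot]
    _ ≤ M + e := by gcongr; exact hM ε hε z

lemma circleAverage_logInt {K : Set ℂ} [CompactSpace K] (μ : Measure K) [IsFiniteMeasure μ] {c : ℂ}
    {ρ : ℝ} (hρ : 0 < ρ) (h : Disjoint (closedBall c ρ) K) :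
    Real.circleAverage (logInt μ) c ρ = logInt μ c := by
  have hs : ∀ θ, circleMap c ρ θ ∉ K := fun θ =>
    disjoint_left.1 h (circleMap_mem_closedBall c hρ.le θ)
  unfold logInt
  rw [circleAverage_integral (k := fun z w => Real.log ‖z - w‖) μ
    (continuous_log_norm_sub (continuous_circleMap c ρ) hs)]
  refine integral_congr_ae (Eventually.of_forall fun w => ?_)
  have hw : ρ < ‖c - w‖ := by
    have := disjoint_right.1 h w.2
    rwa [mem_closedBall, not_le, dist_comm, dist_eq_norm] at this
  have h1 : 1 ≤ ρ⁻¹ * ‖c - w‖ := by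
    rw [inv_mul_eq_div, one_le_div hρ]; exact hw.le
  change Real.circleAverage (fun z => Real.log ‖z - w‖) c ρ = _
  rw [circleAverage_log_norm_sub_const_eq_log_radius_add_posLog hρ.ne',
    Real.posLog_eq_log (by rwa [abs_of_nonneg (by positivity)]),
    Real.log_mul (by positivity) (by linarith [norm_nonneg (c - w)])]
  simp

lemma continuousOn_logInt {K : Set ℂ} [CompactSpace K] (μ : Measure K) [IsFiniteMeasure μ] :
    ContinuousOn (logInt μ) Kᶜ := by
  rw [continuousOn_iff_continuous_domRestrict]
  have : LocallyCompactSpace (Kᶜ : Set ℂ) :=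
    (isClosed_of_compactSpace K).isOpen_compl.locallyCompactSpace
  have := continuous_parametric_integral_of_continuous (μ := μ) (s := univ)
    (f := fun (z : (Kᶜ : Set ℂ)) (w : K) => Real.log ‖(z : ℂ) - w‖)
    (continuous_log_norm_sub continuous_subtype_val fun z => z.2) isCompact_univ
  simp only [Measure.restrict_univ] at this
  exact this

lemma circleAverage_norm_sub_sq (c a : ℂ) (ρ : ℝ) :
    Real.circleAverage (fun z => ‖z - a‖ ^ 2) c ρ = ‖c - a‖ ^ 2 + ρ ^ 2 := by
  have h : ∀ θ : ℝ, ‖circleMap c ρ θ - a‖ ^ 2 = ‖c - a‖ ^ 2 + ρ ^ 2 +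
      (2 * ρ * (c - a).re * Real.cos θ + 2 * ρ * (c - a).im * Real.sin θ) := by
    intro θ
    have hx : circleMap c ρ θ - a = (c - a) + ρ * Complex.exp (θ * Complex.I) := by
      simp [circleMap]; ring
    rw [hx, Complex.exp_mul_I, ← Complex.normSq_eq_norm_sq, ← Complex.normSq_eq_norm_sq,
      Complex.normSq_apply, Complex.normSq_apply]
    simp [Complex.cos_ofReal_re, Complex.sin_ofReal_re]
    nlinarith [Real.sin_sq_add_cos_sq θ]
  unfold Real.circleAverage
  simp only [h]
  rw [intervalIntegral.integral_add (by simp) (by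
      apply Continuous.intervalIntegrable; fun_prop),
    intervalIntegral.integral_add (by apply Continuous.intervalIntegrable; fun_prop)
      (by apply Continuous.intervalIntegrable; fun_prop)]
  simp
  field_simp

/-- A compactly supported measure with bounded logarithmic potential does not charge only the
`-∞` set of a subharmonic function. -/
lemma not_bounded_potential_of_bot {K Ω : Set ℂ} [CompactSpace K] (μ : Measure K)
    [IsProbabilityMeasure μ] {u : ℂ → EReal} (hu : SubharmonicOn u Ω) {z₀ : ℂ} {r M : ℝ}
    (hr : 0 < r) (hK : K ⊆ closedBall z₀ r) (hΩ : closedBall z₀ (4 * r) ⊆ Ω)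
    (hbot : ∀ z ∈ K, u z = ⊥) (hM : ∀ ε > 0, ∀ z, logPot ε μ z ≤ M) : False := by
  have husc := hu.2.1
  have htop := hu.2.2.1
  obtain ⟨B, hB⟩ := exists_real_bound husc htop (isCompact_closedBall z₀ (4 * r)) hΩ
  obtain ⟨z₁, hz₁, hz₁u⟩ := exists_ne_bot_of_subharmonicOn hu hr
    ((ball_subset_closedBall.trans (closedBall_subset_closedBall (by linarith))).trans hΩ)
  have hz₁K : z₁ ∉ K := fun h => hz₁u (hbot _ h)
  have hz₁4 : z₁ ∈ closedBall z₀ (4 * r) :=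
    closedBall_subset_closedBall (by linarith) (ball_subset_closedBall hz₁)
  obtain ⟨A, hA⟩ : ∃ A : ℝ, u z₁ = A :=
    ⟨(u z₁).toReal, (EReal.coe_toReal (htop _ (hΩ hz₁4)) hz₁u).symm⟩
  have hg1 : logInt μ z₁ ≤ Real.log (2 * r) := by
    have : ∀ w : K, Real.log ‖z₁ - w‖ ≤ Real.log (2 * r) := fun w => by
      have hne : 0 < ‖z₁ - w‖ := norm_pos_iff.2 (sub_ne_zero.2 fun h => hz₁K (h ▸ w.2))
      apply Real.log_le_log hne
      have h1 := dist_triangle_right z₁ w z₀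
      have h2 := mem_closedBall.1 (hK w.2)
      rw [mem_ball] at hz₁
      rw [← dist_eq_norm]; linarith
    refine (integral_mono (integrable_log_norm_sub μ hz₁K) (integrable_const _) this).trans ?_
    simp
  have hsph : ∀ z ∈ sphere z₀ (4 * r), z ∉ K ∧ Real.log (3 * r) ≤ logInt μ z := by
    intro z hz
    have h3 : ∀ w ∈ K, 3 * r ≤ ‖z - w‖ := fun w hw => by
      have h1 := dist_triangle z w z₀
      have h2 := mem_closedBall.1 (hK hw)
      rw [mem_sphere] at hz
      rw [← dist_eq_norm]; linarith
    have hzK : z ∉ K := fun h => by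
      have := h3 z h
      simp at this; linarith
    refine ⟨hzK, ?_⟩
    have := integral_mono (μ := μ) (integrable_const _) (integrable_log_norm_sub μ hzK)
      (fun w : K => Real.log_le_log (by positivity) (h3 w w.2))
    simpa using! this
  set κ := Real.log (3 * r) - Real.log (2 * r) with hκ
  have hκ0 : 0 < κ := sub_pos.2 (Real.log_lt_log (by positivity) (by linarith))
  set τ := κ / (32 * r ^ 2) with hτ
  have hτ0 : 0 < τ := by positivity
  have hτ16 : τ * (4 * r) ^ 2 = κ / 2 := by rw [hτ]; field_simp; norm_num
  set lam := 2 * (|B| + |A| + 1) / κ with hlam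
  have hlam0 : 0 < lam := by positivity
  have hlamκ : lam * (κ / 2) = |B| + |A| + 1 := by rw [hlam]; field_simp
  set G : ℂ → ℝ := fun z => lam * (-logInt μ z + τ * ‖z - z₀‖ ^ 2) with hG
  have hGc : ContinuousOn G Kᶜ := by
    have := continuousOn_logInt μ
    fun_prop
  have hGle : ∀ z ∈ closedBall z₀ (4 * r), z ∉ K → G z ≤ lam * (M + κ / 2) := by
    intro z hz hzK
    rw [mem_closedBall, dist_eq_norm] at hz
    have : τ * ‖z - z₀‖ ^ 2 ≤ κ / 2 := by rw [← hτ16]; gcongr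
    have := neg_logInt_le μ hM hzK
    simp only [hG]
    gcongr
  have hG1 : lam * (-Real.log (2 * r)) ≤ G z₁ := by
    simp only [hG]
    gcongr
    have : 0 ≤ τ * ‖z₁ - z₀‖ ^ 2 := by positivity
    linarith
  have hGsph : ∀ z ∈ sphere z₀ (4 * r), B + G z < A + G z₁ := by
    intro z hz
    have h1 := (hsph z hz).2
    rw [mem_sphere, dist_eq_norm] at hz
    have h2 : G z ≤ lam * (-Real.log (3 * r) + κ / 2) := by
      simp only [hG, hz, hτ16]
      gcongr
    have h3 : lam * (-Real.log (3 * r) + κ / 2) = lam * (-Real.log (2 * r)) - lam * (κ / 2) := by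
      rw [hκ]; ring
    have := le_abs_self B
    have := neg_abs_le A
    linarith
  set m₁ := A + G z₁ with hm₁
  set N := |m₁ - lam * (M + κ / 2)| + |A| + 1 with hN
  set L := closedBall z₀ (4 * r) ∩ u ⁻¹' Ici ((-N : ℝ) : EReal) with hL
  have hLc : IsCompact L :=
    (husc.mono hΩ).isCompact_inter_preimage_Ici (isCompact_closedBall _ _) _
  have hLK : ∀ z ∈ L, z ∉ K := by
    intro z hz hzK
    have h := hz.2
    rw [mem_preimage, hbot z hzK, mem_Ici] at h
    exact EReal.coe_ne_bot _ (le_bot_iff.1 h)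
  have hz₁L : z₁ ∈ L := by
    refine ⟨hz₁4, ?_⟩
    rw [mem_preimage, hA, mem_Ici, EReal.coe_le_coe_iff]
    have := neg_abs_le A
    have := abs_nonneg (m₁ - lam * (M + κ / 2))
    linarith
  have hΦusc : UpperSemicontinuousOn (fun z => u z + ((G z : ℝ) : EReal)) L := by
    refine (husc.mono (inter_subset_left.trans hΩ)).add' ?_ fun z hz => ?_
    · exact ((continuous_coe_real_ereal.comp_continuousOn hGc).mono hLK).upperSemicontinuousOn
    · exact EReal.continuousAt_add (Or.inr (EReal.coe_ne_bot _)) (Or.inr (EReal.coe_ne_top _))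
  obtain ⟨c, hcL, hcmax⟩ := hΦusc.exists_isMaxOn ⟨z₁, hz₁L⟩ hLc
  have hc4 := hcL.1
  have hcK := hLK c hcL
  have hcbot : u c ≠ ⊥ := fun h => by
    have h' := hcL.2
    rw [mem_preimage, h, mem_Ici] at h'
    exact EReal.coe_ne_bot _ (le_bot_iff.1 h')
  obtain ⟨uc, huc⟩ : ∃ uc : ℝ, u c = uc :=
    ⟨(u c).toReal, (EReal.coe_toReal (htop _ (hΩ hc4)) hcbot).symm⟩
  have hm : m₁ ≤ uc + G c := by
    have h := hcmax hz₁L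
    simp only [mem_ofPred_eq, hA, huc] at h
    exact_mod_cast h
  have hcs : c ∉ sphere z₀ (4 * r) := fun h => by
    have h1 := hGsph c h
    have h2 := hB c hc4
    rw [huc, EReal.coe_le_coe_iff] at h2
    linarith
  have hall : ∀ z ∈ closedBall z₀ (4 * r), z ∉ K → u z ≤ ((uc + G c - G z : ℝ) : EReal) := by
    intro z hz hzK
    by_cases hzL : z ∈ L
    · have h := hcmax hzL
      simp only [mem_ofPred_eq, huc] at h
      have hzb : u z ≠ ⊥ := fun hb => by
        have h' := hzL.2
        rw [mem_preimage, hb, mem_Ici] at h'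
        exact EReal.coe_ne_bot _ (le_bot_iff.1 h')
      have hx := EReal.coe_toReal (htop _ (hΩ hz)) hzb
      rw [← hx] at h ⊢
      have h'' : (u z).toReal + G z ≤ uc + G c := by exact_mod_cast h
      rw [EReal.coe_le_coe_iff]
      linarith
    · have h : u z < ((-N : ℝ) : EReal) := by
        by_contra! h
        exact hzL ⟨hz, h⟩
      refine h.le.trans (EReal.coe_le_coe_iff.2 ?_)
      have h1 := hGle z hz hzK
      have h2 := neg_abs_le (m₁ - lam * (M + κ / 2))
      have h3 := abs_nonneg A
      linarith
  have hcb : c ∈ ball z₀ (4 * r) := by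
    rw [mem_ball]
    exact lt_of_le_of_ne (mem_closedBall.1 hc4) hcs
  obtain ⟨ρ, hρ, hρs⟩ := Metric.nhds_basis_closedBall.mem_iff.1
    ((isOpen_ball.inter (isClosed_of_compactSpace K).isOpen_compl).mem_nhds ⟨hcb, hcK⟩)
  have hρ4 : closedBall c ρ ⊆ closedBall z₀ (4 * r) := fun z hz =>
    ball_subset_closedBall (hρs hz).1
  have hρK : Disjoint (closedBall c ρ) K := disjoint_left.2 fun z hz => (hρs hz).2
  have hGs : ContinuousOn G (sphere c ρ) :=
    hGc.mono fun z hz => (hρs (sphere_subset_closedBall hz)).2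
  have hlc : ContinuousOn (logInt μ) (sphere c ρ) :=
    (continuousOn_logInt μ).mono fun z hz => (hρs (sphere_subset_closedBall hz)).2
  have hGcirc : Continuous fun θ : ℝ => G (circleMap c ρ θ) :=
    hGs.comp_continuous (continuous_circleMap c ρ) fun θ => circleMap_mem_sphere c hρ.le θ
  have hsub := submean_circleAverage (φ := fun z => uc + G c - G z) hu.2.2.2.2 hρ
    (hρ4.trans hΩ) (continuous_const.sub hGcirc) fun z hz =>
      hall z (hρ4 (sphere_subset_closedBall hz)) (hρs (sphere_subset_closedBall hz)).2
  have hGi : CircleIntegrable G c ρ := hGs.circleIntegrable hρ.le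
  have hli : CircleIntegrable (logInt μ) c ρ := hlc.circleIntegrable hρ.le
  have hni : CircleIntegrable (fun z => ‖z - z₀‖ ^ 2) c ρ :=
    (by fun_prop : Continuous fun z : ℂ => ‖z - z₀‖ ^ 2).continuousOn.circleIntegrable hρ.le
  have havG : Real.circleAverage G c ρ = G c + lam * τ * ρ ^ 2 := by
    have : G = (lam * τ) • (fun z => ‖z - z₀‖ ^ 2) - lam • logInt μ := by
      ext z; simp [hG]; ring
    rw [this, Real.circleAverage_sub hni.const_smul hli.const_smul, Real.circleAverage_smul,
      Real.circleAverage_smul, circleAverage_logInt μ hρ hρK, circleAverage_norm_sub_sq]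
    simp
    ring
  have hav : Real.circleAverage (fun z => uc + G c - G z) c ρ = uc - lam * τ * ρ ^ 2 := by
    have : (fun z => uc + G c - G z) = (fun _ => uc + G c) - G := rfl
    rw [this, Real.circleAverage_sub (circleIntegrable_const _ _ _) hGi,
      Real.circleAverage_const, havG]
    ring
  rw [hav, huc, EReal.coe_le_coe_iff] at hsub
  have : 0 < lam * τ * ρ ^ 2 := by positivity
  linarith

lemma circleAverage_mono_of_ne {f g : ℂ → ℝ} {c p : ℂ} {r : ℝ} (hr : r ≠ 0)
    (hf : CircleIntegrable f c r) (hg : CircleIntegrable g c r) (h : ∀ z ≠ p, f z ≤ g z) :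
    Real.circleAverage f c r ≤ Real.circleAverage g c r := by
  refine mul_le_mul_of_nonneg_left (intervalIntegral.integral_mono_ae Real.two_pi_pos.le hf hg ?_)
    (by positivity)
  filter_upwards [((countable_singleton p).preimage_circleMap c hr).ae_notMem volume] with θ hθ
  exact h _ hθ

lemma norm_conj_mul_add_sq_le (x a : ℂ) (ε : ℝ) :
    ‖(starRingEnd ℂ) a * x + (ε : ℂ) ^ 2‖ ^ 2 ≤ (‖x‖ ^ 2 + ε ^ 2) * (‖a‖ ^ 2 + ε ^ 2) := by
  simp only [← Complex.normSq_eq_norm_sq, Complex.normSq_apply]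
  have h1 : ((ε : ℂ) ^ 2).re = ε ^ 2 := by norm_cast
  have h2 : ((ε : ℂ) ^ 2).im = 0 := by norm_cast
  simp only [Complex.add_re, Complex.mul_re, Complex.conj_re, Complex.conj_im, Complex.add_im,
    Complex.mul_im, h1, h2]
  nlinarith [sq_nonneg (ε * (x.re - a.re)), sq_nonneg (ε * (x.im - a.im))]

lemma circleAverage_logKer_le {ε : ℝ} (hε : 0 < ε) (c w : ℂ) {ρ : ℝ} (hρ : 0 < ρ) :
    Real.circleAverage (fun z => logKer ε z w) c ρ ≤ logKer ε c w := by
  have hcont : Continuous fun z => logKer ε z w :=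
    (continuous_logKer hε).comp (f := fun z : ℂ => (z, w)) (by fun_prop)
  have hi : CircleIntegrable (fun z => logKer ε z w) c ρ :=
    hcont.continuousOn.circleIntegrable hρ.le
  set a := c - w with ha
  by_cases ha0 : a = 0
  · refine Real.circleAverage_mono_on_of_le_circle hi fun z _ => ?_
    unfold logKer
    have := Real.log_le_log (by positivity)
      (show ‖c - w‖ ^ 2 + ε ^ 2 ≤ ‖z - w‖ ^ 2 + ε ^ 2 by
        rw [← ha, ha0, norm_zero]; gcongr; positivity)
    linarith
  have hca : (starRingEnd ℂ) a ≠ 0 := by simpa using ha0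
  set p : ℂ := w - ε ^ 2 / (starRingEnd ℂ) a with hp
  set C := 1 / 2 * Real.log (‖a‖ ^ 2 + ε ^ 2) - Real.log ‖a‖ with hC
  have hapos : 0 < ‖a‖ := norm_pos_iff.2 ha0
  have hli : CircleIntegrable (fun z => Real.log ‖z - p‖) c ρ :=
    circleIntegrable_log_norm_sub_const ρ
  have hle : ∀ z ≠ p, logKer ε z w ≤ C - Real.log ‖z - p‖ := by
    intro z hz
    have h1 := norm_conj_mul_add_sq_le (z - w) a ε
    have h2 : (starRingEnd ℂ) a * (z - w) + (ε : ℂ) ^ 2 = (starRingEnd ℂ) a * (z - p) := by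
      rw [hp]; field_simp; ring
    have hzp : 0 < ‖z - p‖ := norm_pos_iff.2 (sub_ne_zero.2 hz)
    rw [h2, norm_mul, RCLike.norm_conj] at h1
    have h3 := Real.log_le_log (by positivity) h1
    rw [Real.log_mul (logKer_arg_pos hε z w).ne' (by positivity), Real.log_pow,
      Real.log_mul hapos.ne' hzp.ne'] at h3
    unfold logKer
    push_cast at h3
    linarith
  refine (circleAverage_mono_of_ne (g := (fun _ => C) - fun z => Real.log ‖z - p‖) hρ.ne' hi
    ((circleIntegrable_const _ _ _).sub hli) hle).trans ?_
  rw [Real.circleAverage_sub (circleIntegrable_const _ _ _) hli, Real.circleAverage_const,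
    circleAverage_log_norm_sub_const_eq_log_radius_add_posLog hρ.ne']
  have hcp : (starRingEnd ℂ) a * (c - p) = ((‖a‖ ^ 2 + ε ^ 2 : ℝ) : ℂ) := by
    have h2 : (starRingEnd ℂ) a * (c - p) = (starRingEnd ℂ) a * a + (ε : ℂ) ^ 2 := by
      rw [show c - p = a + ε ^ 2 / (starRingEnd ℂ) a by rw [hp, ha]; ring]
      field_simp
    rw [h2, mul_comm, Complex.mul_conj, Complex.normSq_eq_norm_sq]
    push_cast; ring
  have hapos2 : 0 < ‖a‖ ^ 2 + ε ^ 2 := by positivity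
  have hncp : ‖a‖ * ‖c - p‖ = ‖a‖ ^ 2 + ε ^ 2 := by
    have := congrArg norm hcp
    rwa [norm_mul, RCLike.norm_conj, Complex.norm_real, Real.norm_of_nonneg hapos2.le] at this
  have hcp0 : 0 < ‖c - p‖ := by
    by_contra! h
    nlinarith
  have h5 : Real.log (ρ⁻¹ * ‖c - p‖) ≤ (ρ⁻¹ * ‖c - p‖).posLog := le_max_right _ _
  rw [Real.log_mul (by positivity) hcp0.ne', Real.log_inv] at h5
  have h6 := congrArg Real.log hncp
  rw [Real.log_mul hapos.ne' hcp0.ne'] at h6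
  unfold logKer
  rw [← ha]
  linarith

lemma circleAverage_logPot_le {K : Set ℂ} [CompactSpace K] {ε : ℝ} (hε : 0 < ε) (μ : Measure K)
    [IsFiniteMeasure μ] (c : ℂ) {ρ : ℝ} (hρ : 0 < ρ) :
    Real.circleAverage (logPot ε μ) c ρ ≤ logPot ε μ c := by
  have hk : Continuous fun p : ℝ × K => logKer ε (circleMap c ρ p.1) p.2 :=
    (continuous_logKer hε).comp (f := fun p : ℝ × K => (circleMap c ρ p.1, (p.2 : ℂ)))
      (((continuous_circleMap c ρ).comp continuous_fst).prodMk (by fun_prop))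
  change Real.circleAverage (fun z => ∫ w : K, logKer ε z w ∂μ) c ρ ≤ _
  rw [circleAverage_integral μ hk]
  refine integral_mono (continuous_integrable_of_compactSpace μ ?_) (integrable_logKer hε μ c)
    (fun w => circleAverage_logKer_le hε c w hρ)
  simp only [Real.circleAverage, smul_eq_mul]
  refine continuous_const.mul
    (intervalIntegral.continuous_parametric_intervalIntegral_of_continuous' (μ := volume)
      (f := fun (w : K) θ => logKer ε (circleMap c ρ θ) w) ?_ _ _)
  exact hk.comp (f := fun p : K × ℝ => (p.2, p.1)) (by fun_prop)

lemma submeanOn_iInf {S : ℕ → ℂ → ℝ} {Ω : Set ℂ} (hc : ∀ n, Continuous (S n))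
    (hanti : ∀ z ∈ Ω, Antitone fun n => S n z)
    (hsub : ∀ n c r, 0 < r → closedBall c r ⊆ Ω → S n c ≤ Real.circleAverage (S n) c r) :
    SubmeanOn (fun z => ⨅ n, ((S n z : ℝ) : EReal)) Ω := by
  intro c r hr hΩ φ hφ h
  set h' : ℕ → ℝ → ℝ := fun n θ => max (S n (circleMap c r θ)) (φ θ) with hh'
  have hcS : ∀ n, Continuous fun θ => S n (circleMap c r θ) := fun n =>
    (hc n).comp (continuous_circleMap c r)
  have hcont : ∀ n, Continuous (h' n) := fun n => (hcS n).max hφ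
  have hle : ∀ n, S n c ≤ (2 * Real.pi)⁻¹ * ∫ θ in (0:ℝ)..(2 * Real.pi), h' n θ := fun n =>
    (hsub n c r hr hΩ).trans <| mul_le_mul_of_nonneg_left
      (intervalIntegral.integral_mono Real.two_pi_pos.le ((hcS n).intervalIntegrable _ _)
        ((hcont n).intervalIntegrable _ _) fun θ => le_max_left _ _) (by positivity)
  have hmem : ∀ θ, circleMap c r θ ∈ Ω := fun θ => hΩ (circleMap_mem_closedBall c hr.le θ)
  have hlim : Tendsto (fun n => (2 * Real.pi)⁻¹ * ∫ θ in (0:ℝ)..(2 * Real.pi), h' n θ) atTop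
      (nhds ((2 * Real.pi)⁻¹ * ∫ θ in (0:ℝ)..(2 * Real.pi), φ θ)) := by
    refine Tendsto.const_mul _ (intervalIntegral.tendsto_integral_filter_of_dominated_convergence
      (fun θ => |h' 0 θ| + |φ θ|) (Eventually.of_forall fun n => (hcont n).aestronglyMeasurable)
      (Eventually.of_forall fun n => Eventually.of_forall fun θ _ => ?_)
      (((hcont 0).abs.add hφ.abs).intervalIntegrable _ _)
      (Eventually.of_forall fun θ _ => ?_))
    · have h1 : φ θ ≤ h' n θ := le_max_right _ _
      have h2 : h' n θ ≤ h' 0 θ := max_le_max (hanti _ (hmem θ) (Nat.zero_le n)) le_rfl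
      rw [Real.norm_eq_abs, abs_le]
      constructor
      · linarith [neg_abs_le (φ θ), abs_nonneg (h' 0 θ)]
      · linarith [le_abs_self (h' 0 θ), abs_nonneg (φ θ)]
    · refine Metric.tendsto_atTop.2 fun e he => ?_
      have h1 : (⨅ n, ((S n (circleMap c r θ) : ℝ) : EReal)) < ((φ θ + e : ℝ) : EReal) :=
        (h θ).trans_lt (EReal.coe_lt_coe_iff.2 (by linarith))
      obtain ⟨n₀, hn₀⟩ := iInf_lt_iff.1 h1
      rw [EReal.coe_lt_coe_iff] at hn₀
      refine ⟨n₀, fun n hn => ?_⟩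
      have h2 := hanti _ (hmem θ) hn
      simp only at h2
      have h3 : φ θ ≤ h' n θ := le_max_right _ _
      have h4 : h' n θ < φ θ + e := max_lt (by linarith) (by linarith)
      rw [Real.dist_eq, abs_lt]
      constructor <;> linarith
  have hcoe := (continuous_coe_real_ereal.tendsto _).comp hlim
  refine ge_of_tendsto' hcoe fun n => (iInf_le _ n).trans ?_
  exact EReal.coe_le_coe_iff.2 (hle n)

/-- A compact set on which regularised potentials of probability measures can be uniformly large
is polar. -/
lemma polarSet_of_large {K : Set ℂ} [CompactSpace K] {c : ℂ} {r : ℝ} (hr : 0 < r)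
    (hK : K ⊆ closedBall c r)
    (h : ∀ V₀ : ℝ, ∃ ε ∈ Ioo (0:ℝ) 1, ∃ (μ : ProbabilityMeasure K), ∀ a ∈ K,
      V₀ ≤ logPot ε (μ : Measure K) a) : PolarSet K := by
  choose ε hε μ hμ using fun j : ℕ => h (2 ^ j)
  set L := 2 * r + 3 with hL
  have hL0 : 0 ≤ Real.log L := Real.log_nonneg (by linarith)
  set t : ℕ → ℂ → ℝ := fun j z => -((1 / 2) ^ j * (logPot (ε j) (μ j : Measure K) z + Real.log L))
    with ht
  set S : ℕ → ℂ → ℝ := fun n z => ∑ j ∈ Finset.range n, t j z with hS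
  set Ω := ball c (r + 1) with hΩ
  have hpot : ∀ j, Continuous (logPot (ε j) (μ j : Measure K)) := fun j =>
    continuous_logPot (hε j).1 _
  have htc : ∀ j, Continuous (t j) := fun j => by
    have := hpot j
    fun_prop
  have hSc : ∀ n, Continuous (S n) := fun n => continuous_finsetSum _ fun j _ => htc j
  have htneg : ∀ j, ∀ z ∈ Ω, t j z ≤ 0 := by
    intro j z hz
    have h1 : -Real.log L ≤ logPot (ε j) (μ j : Measure K) z := by
      refine neg_log_le_logPot (hε j).1 _ fun w hw => ?_
      have h2 := dist_triangle_right z w c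
      have h3 := mem_closedBall.1 (hK hw)
      have h4 := mem_ball.1 hz
      have h5 : ‖z - w‖ ≤ 2 * r + 1 := by rw [← dist_eq_norm]; linarith
      have h6 := (hε j).1
      have h7 := (hε j).2
      have h8 := norm_nonneg (z - w)
      nlinarith
    have : 0 ≤ (1 / 2 : ℝ) ^ j * (logPot (ε j) (μ j : Measure K) z + Real.log L) :=
      mul_nonneg (by positivity) (by linarith)
    simp only [ht]; linarith
  have hanti : ∀ z ∈ Ω, Antitone fun n => S n z := fun z hz =>
    antitone_nat_of_succ_le fun n => by
      simp only [hS, Finset.sum_range_succ]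
      linarith [htneg n z hz]
  have htsub : ∀ j (a : ℂ) (ρ : ℝ), 0 < ρ → t j a ≤ Real.circleAverage (t j) a ρ := by
    intro j a ρ hρ
    have h1 := circleAverage_logPot_le (hε j).1 (μ j : Measure K) a hρ
    have hci : CircleIntegrable (logPot (ε j) (μ j : Measure K)) a ρ :=
      (hpot j).continuousOn.circleIntegrable hρ.le
    have h2 : t j = (fun _ => -((1 / 2) ^ j * Real.log L)) -
        ((1 / 2 : ℝ) ^ j) • logPot (ε j) (μ j : Measure K) := by
      ext z; simp [ht]; ring
    rw [h2, Real.circleAverage_sub (circleIntegrable_const _ _ _) hci.const_smul,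
      Real.circleAverage_const, Real.circleAverage_smul]
    simp only [Pi.sub_apply, Pi.smul_apply, smul_eq_mul]
    gcongr
  refine ⟨Ω, hK.trans (closedBall_subset_ball (by linarith)),
    fun z => ⨅ n, ((S n z : ℝ) : EReal), ⟨isOpen_ball, ?_, ?_, ?_, ?_⟩, ?_⟩
  · exact upperSemicontinuousOn_iInf fun n =>
      (continuous_coe_real_ereal.comp (hSc n)).continuousOn.upperSemicontinuousOn
  · exact fun z _ => ((iInf_le (fun n => ((S n z : ℝ) : EReal)) 0).trans_lt (EReal.coe_lt_top _)).ne
  · intro z hz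
    have hpc : connectedComponentIn Ω z = Ω :=
      (convex_ball c (r + 1)).isPreconnected.connectedComponentIn hz
    refine ⟨c + ((r + 1 / 2 : ℝ) : ℂ), ?_, ?_⟩
    · rw [hpc, hΩ, mem_ball, dist_eq_norm, add_sub_cancel_left, Complex.norm_real,
        Real.norm_of_nonneg (by linarith)]
      linarith
    · set z₁ := c + ((r + 1 / 2 : ℝ) : ℂ)
      have hb : ∀ j, -((1 / 2) ^ j * (-Real.log (1 / 2) + Real.log L)) ≤ t j z₁ := by
        intro j
        simp only [ht]
        gcongr
        refine logPot_le_neg_log (hε j).1 (by norm_num) _ fun w hw => ?_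
        have h1 := dist_triangle z₁ w c
        have h2 := mem_closedBall.1 (hK hw)
        have h3 : dist z₁ c = r + 1 / 2 := by
          rw [dist_eq_norm, add_sub_cancel_left, Complex.norm_real,
            Real.norm_of_nonneg (by linarith)]
        rw [← dist_eq_norm]; linarith
      have hb0 : 0 ≤ -Real.log (1 / 2) + Real.log L := by
        have := Real.log_nonpos (by norm_num) (by norm_num : (1 / 2 : ℝ) ≤ 1)
        linarith
      have hSb : ∀ n, -(2 * (-Real.log (1 / 2) + Real.log L)) ≤ S n z₁ := by
        intro n
        calc -(2 * (-Real.log (1 / 2) + Real.log L))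
            ≤ -((∑ j ∈ Finset.range n, (1 / 2 : ℝ) ^ j) * (-Real.log (1 / 2) + Real.log L)) := by
              gcongr
              exact sum_geometric_two_le n
          _ = ∑ j ∈ Finset.range n, -((1 / 2) ^ j * (-Real.log (1 / 2) + Real.log L)) := by
              rw [Finset.sum_neg_distrib, Finset.sum_mul]
          _ ≤ S n z₁ := Finset.sum_le_sum fun j _ => hb j
      have : ((-(2 * (-Real.log (1 / 2) + Real.log L)) : ℝ) : EReal) ≤
          ⨅ n, ((S n z₁ : ℝ) : EReal) := le_iInf fun n => EReal.coe_le_coe_iff.2 (hSb n)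
      exact ((EReal.bot_lt_coe _).trans_le this).ne'
  · refine submeanOn_iInf hSc hanti fun n a ρ hρ _ => ?_
    have h1 : S n = ∑ j ∈ Finset.range n, t j := by ext z; simp [hS]
    rw [h1, Real.circleAverage_sum fun j _ => (htc j).continuousOn.circleIntegrable hρ.le,
      Finset.sum_apply]
    exact Finset.sum_le_sum fun j _ => htsub j a ρ hρ
  · intro z hz
    have htK : ∀ j, t j z ≤ -1 := by
      intro j
      have h1 := hμ j z hz
      have h2 : (1 : ℝ) ≤ (1 / 2 : ℝ) ^ j * (logPot (ε j) (μ j : Measure K) z + Real.log L) := by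
        calc (1 : ℝ) = (1 / 2 : ℝ) ^ j * 2 ^ j := by rw [← mul_pow]; norm_num
          _ ≤ _ := by gcongr; linarith
      simp only [ht]; linarith
    refine (EReal.eq_bot_iff_forall_lt _).2 fun y => ?_
    obtain ⟨n, hn⟩ := exists_nat_gt (-y)
    refine (iInf_le _ n).trans_lt (EReal.coe_lt_coe_iff.2 ?_)
    have : S n z ≤ ∑ j ∈ Finset.range n, (-1 : ℝ) := Finset.sum_le_sum fun j _ => htK j
    simp at this
    linarith

lemma continuous_deriv_smoothTransition : Continuous (deriv Real.smoothTransition) :=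
  (Real.smoothTransition.contDiff (n := 1)).continuous_deriv (by norm_num)

lemma hasDerivAt_smoothTransition (x : ℝ) :
    HasDerivAt Real.smoothTransition (deriv Real.smoothTransition x) x :=
  ((Real.smoothTransition.contDiff (n := 1)).differentiable (by norm_num) x).hasDerivAt

lemma exists_deriv_smoothTransition_bound :
    ∃ C > 0, ∀ x, |deriv Real.smoothTransition x| ≤ C := by
  obtain ⟨C, hC⟩ := (isCompact_Icc (a := (0:ℝ)) (b := 1)).exists_bound_of_continuousOn
    continuous_deriv_smoothTransition.continuousOn
  refine ⟨max C 1, by positivity, fun x => ?_⟩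
  by_cases hx : x ∈ Icc (0:ℝ) 1
  · exact (hC x hx).trans (le_max_left _ _)
  · have : deriv Real.smoothTransition x = 0 := by
      rcases not_and_or.1 hx with h | h
      · have h' : Real.smoothTransition =ᶠ[nhds x] fun _ => 0 :=
          (eventually_lt_nhds (not_le.1 h)).mono fun y hy =>
            Real.smoothTransition.zero_of_nonpos hy.le
        rw [h'.deriv_eq, deriv_const]
      · have h' : Real.smoothTransition =ᶠ[nhds x] fun _ => 1 :=
          (eventually_gt_nhds (not_le.1 h)).mono fun y hy =>
            Real.smoothTransition.one_of_one_le hy.le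
        rw [h'.deriv_eq, deriv_const]
    rw [this, abs_zero]
    positivity

lemma contDiff_logPot {K : Set ℂ} [CompactSpace K] (μ : Measure K) [IsFiniteMeasure μ]
    {ε : ℝ} (hε : 0 < ε) : ContDiff ℝ 1 (logPot ε μ) :=
  contDiff_one_iff_hasFDerivAt.2
    ⟨logPotDeriv ε μ, continuous_logPotDeriv μ hε, logPot_hasFDerivAt μ hε⟩

lemma lintegral_sq_logPotDeriv_le {K : Set ℂ} [CompactSpace K] (μ : Measure K)
    [IsProbabilityMeasure μ] {c : ℂ} {R ε : ℝ} (hε : 0 < ε) (hε1 : ε ≤ 1) (hK : K ⊆ ball c R) :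
    ∫⁻ z in ball c R, ‖logPotDeriv ε μ z‖ₑ ^ 2 ≤
      ENNReal.ofReal (energyConst R + 4 * Real.pi * ∫ z : K, logPot ε μ z ∂μ) := by
  refine le_trans (lintegral_mono fun z => ?_) (lintegral_sq_invKer_le μ hε hε1 hK)
  gcongr
  rw [← ofReal_norm, ← ofReal_integral_eq_lintegral_ofReal (integrable_invKer μ hε z)
    (Eventually.of_forall fun w => invKer_nonneg _ _ _)]
  exact ENNReal.ofReal_le_ofReal (norm_logPotDeriv_le μ hε z)

/-- If potentials can be made uniformly large on `K`, there are cutoff functions which are `1`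
near `K`, tend to `0` off `K`, and have small Dirichlet integral. -/
lemma exists_cutoffs {K : Set ℂ} [CompactSpace K] {c : ℂ} {R : ℝ} (hK : K ⊆ ball c R)
    (h : ∀ V₀ : ℝ, ∃ ε ∈ Ioo (0:ℝ) 1, ∃ (μ : ProbabilityMeasure K) (V : ℝ), V₀ ≤ V ∧
      (∀ a ∈ K, V ≤ logPot ε (μ : Measure K) a) ∧
      ∫ z : K, logPot ε (μ : Measure K) z ∂(μ : Measure K) = V) :
    ∃ χ : ℕ → ℂ → ℝ, (∀ n, ContDiff ℝ 1 (χ n)) ∧ (∀ n z, χ n z ∈ Icc (0:ℝ) 1) ∧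
      (∀ n, ∀ a ∈ K, ∀ᶠ z in nhds a, χ n z = 1) ∧ (∀ z ∉ K, ∀ᶠ n in atTop, χ n z = 0) ∧
      Tendsto (fun n => ∫⁻ z in ball c R, ‖fderiv ℝ (χ n) z‖ₑ ^ 2) atTop (nhds 0) := by
  choose ε hε μ V hV hlow hen using fun n : ℕ => h (n + 1)
  obtain ⟨C, hC0, hC⟩ := exists_deriv_smoothTransition_bound
  have hVpos : ∀ n, 0 < V n := fun n => by
    have := hV n
    have := n.cast_nonneg (α := ℝ)
    linarith
  set U : ℕ → ℂ → ℝ := fun n => logPot (ε n) (μ n : Measure K) with hU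
  have hUc : ∀ n, ContDiff ℝ 1 (U n) := fun n => contDiff_logPot _ (hε n).1
  set χ : ℕ → ℂ → ℝ := fun n z => Real.smoothTransition (4 / V n * U n z - 2) with hχ
  have hder : ∀ n z, HasFDerivAt (χ n) (deriv Real.smoothTransition (4 / V n * U n z - 2) •
      ((4 / V n) • logPotDeriv (ε n) (μ n : Measure K) z)) z := fun n z =>
    (hasDerivAt_smoothTransition _).comp_hasFDerivAt z
      (((logPot_hasFDerivAt (μ n : Measure K) (hε n).1 z).const_mul (4 / V n)).sub_const 2)
  refine ⟨χ, fun n => ?_, fun n z => ⟨Real.smoothTransition.nonneg _,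
    Real.smoothTransition.le_one _⟩, fun n a ha => ?_, fun z hz => ?_, ?_⟩
  · exact (Real.smoothTransition.contDiff (n := 1)).comp
      ((contDiff_const.mul (hUc n)).sub contDiff_const)
  · have h1 : 3 / 4 * V n < U n a := by
      have := hlow n a ha
      have := hVpos n
      simp only [hU]; linarith
    filter_upwards [(hUc n).continuous.continuousAt.eventually_const_lt h1] with z hz
    refine Real.smoothTransition.one_of_one_le ?_
    have := hVpos n
    rw [le_sub_iff_add_le, div_mul_eq_mul_div, le_div_iff₀ this]
    linarith
  · obtain ⟨d, hd, hdK⟩ := Metric.isOpen_iff.1 (isClosed_of_compactSpace K).isOpen_compl z hz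
    have hdw : ∀ w ∈ K, d ≤ ‖z - w‖ := fun w hw => by
      by_contra! h
      exact hdK (by rwa [mem_ball, dist_comm, dist_eq_norm]) hw
    obtain ⟨N, hN⟩ := exists_nat_gt (2 * -Real.log d)
    filter_upwards [eventually_ge_atTop N] with n hn
    refine Real.smoothTransition.zero_of_nonpos ?_
    have h1 : U n z ≤ -Real.log d := logPot_le_neg_log (hε n).1 hd _ hdw
    have h2 := hV n
    have h3 : (N : ℝ) ≤ n := by exact_mod_cast hn
    rw [sub_nonpos, div_mul_eq_mul_div, div_le_iff₀ (hVpos n)]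
    linarith
  · have hb : ∀ n, ∫⁻ z in ball c R, ‖fderiv ℝ (χ n) z‖ₑ ^ 2 ≤
        ENNReal.ofReal ((4 * C) ^ 2 * ((|energyConst R| + 4 * Real.pi) / (n + 1))) := by
      intro n
      have hv := hVpos n
      have h1 : ∀ z, ‖fderiv ℝ (χ n) z‖ₑ ≤
          ENNReal.ofReal (4 * C / V n) * ‖logPotDeriv (ε n) (μ n : Measure K) z‖ₑ := by
        intro z
        rw [(hder n z).fderiv, smul_smul, enorm_smul]
        gcongr
        rw [← ofReal_norm]
        refine ENNReal.ofReal_le_ofReal ?_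
        rw [norm_mul, Real.norm_eq_abs, Real.norm_of_nonneg (by positivity), mul_div_assoc',
          mul_comm]
        gcongr
        exact hC _
      calc ∫⁻ z in ball c R, ‖fderiv ℝ (χ n) z‖ₑ ^ 2
          ≤ ∫⁻ z in ball c R, ENNReal.ofReal (4 * C / V n) ^ 2 *
              ‖logPotDeriv (ε n) (μ n : Measure K) z‖ₑ ^ 2 :=
            lintegral_mono fun z => by rw [← mul_pow]; gcongr; exact h1 z
        _ = ENNReal.ofReal (4 * C / V n) ^ 2 *
              ∫⁻ z in ball c R, ‖logPotDeriv (ε n) (μ n : Measure K) z‖ₑ ^ 2 :=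
            lintegral_const_mul' _ _ (by finiteness)
        _ ≤ ENNReal.ofReal (4 * C / V n) ^ 2 *
              ENNReal.ofReal (energyConst R + 4 * Real.pi * V n) := by
            gcongr
            have := lintegral_sq_logPotDeriv_le (μ n : Measure K) (hε n).1 (hε n).2.le hK
            rwa [hen n] at this
        _ ≤ _ := by
            rw [← ENNReal.ofReal_pow (by positivity), ← ENNReal.ofReal_mul (by positivity)]
            refine ENNReal.ofReal_le_ofReal ?_
            rw [div_pow, div_mul_eq_mul_div, mul_div_assoc]
            refine mul_le_mul_of_nonneg_left ?_ (by positivity)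
            have h2 := hV n
            have hn := n.cast_nonneg (α := ℝ)
            rw [div_le_div_iff₀ (by positivity) (by positivity)]
            have h3 : energyConst R + 4 * Real.pi * V n ≤
                (|energyConst R| + 4 * Real.pi) * V n := by
              have := le_abs_self (energyConst R)
              nlinarith [abs_nonneg (energyConst R)]
            calc (energyConst R + 4 * Real.pi * V n) * (n + 1)
                ≤ ((|energyConst R| + 4 * Real.pi) * V n) * V n := by
                  gcongr
              _ = _ := by ring
    have hlim : Tendsto (fun n : ℕ => ENNReal.ofReal
        ((4 * C) ^ 2 * ((|energyConst R| + 4 * Real.pi) / (n + 1)))) atTop (nhds 0) := by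
      rw [← ENNReal.ofReal_zero]
      refine ENNReal.tendsto_ofReal ?_
      have := (tendsto_one_div_add_atTop_nhds_zero_nat (𝕜 := ℝ)).const_mul
        ((4 * C) ^ 2 * (|energyConst R| + 4 * Real.pi))
      rw [mul_zero] at this
      exact this.congr fun n => by ring
    exact tendsto_of_tendsto_of_tendsto_of_le_of_le tendsto_const_nhds hlim
      (fun _ => zero_le) hb

/-- Twice the Cauchy-Riemann operator `∂/∂z̄` applied to a real-valued function. -/
noncomputable def dbar (P : ℂ → ℝ) (z : ℂ) : ℂ :=
  (fderiv ℝ P z 1 : ℂ) + Complex.I * (fderiv ℝ P z Complex.I : ℂ)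

lemma norm_dbar_le (P : ℂ → ℝ) (z : ℂ) : ‖dbar P z‖ ≤ 2 * ‖fderiv ℝ P z‖ := by
  unfold dbar
  refine (norm_add_le _ _).trans ?_
  have h1 := (fderiv ℝ P z).le_opNorm 1
  have h2 := (fderiv ℝ P z).le_opNorm Complex.I
  simp only [norm_mul, Complex.norm_I, norm_one, mul_one, one_mul, Complex.norm_real] at h1 h2 ⊢
  linarith

lemma continuous_dbar {P : ℂ → ℝ} (hP : ContDiff ℝ 1 P) : Continuous (dbar P) := by
  have h := hP.continuous_fderiv (by norm_num)
  have h1 : Continuous fun z => fderiv ℝ P z 1 := h.clm_apply continuous_const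
  have h2 : Continuous fun z => fderiv ℝ P z Complex.I := h.clm_apply continuous_const
  unfold dbar
  fun_prop

lemma dbar_eq_zero_of_notMem_tsupport {P : ℂ → ℝ} {z : ℂ} (hz : z ∉ tsupport P) :
    dbar P z = 0 := by
  have : fderiv ℝ P z = 0 := by
    by_contra h
    exact hz (support_fderiv_subset ℝ h)
  simp [dbar, this]

lemma hasCompactSupport_dbar {P : ℂ → ℝ} (hc : HasCompactSupport P) :
    HasCompactSupport (dbar P) :=
  HasCompactSupport.intro hc fun _ => dbar_eq_zero_of_notMem_tsupport

lemma dbar_one_sub_mul {χ η : ℂ → ℝ} (hχ : ContDiff ℝ 1 χ) (hη : ContDiff ℝ 1 η) (z : ℂ) :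
    dbar (fun ζ => (1 - χ ζ) * η ζ) z = (1 - χ z : ℝ) * dbar η z - η z * dbar χ z := by
  have h1 := (hχ.differentiable (by norm_num) z).hasFDerivAt
  have h2 := (hη.differentiable (by norm_num) z).hasFDerivAt
  have h3 : fderiv ℝ (fun ζ => (1 - χ ζ) * η ζ) z = _ := ((h1.const_sub 1).mul h2).fderiv
  unfold dbar
  rw [h3]
  simp
  ring

lemma integral_fderiv_eq_zero {G : ℂ → ℂ} (hG : ContDiff ℝ 1 G) (hc : HasCompactSupport G)
    (v : ℂ) : ∫ z, fderiv ℝ G z v = 0 := by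
  have h := hG.continuous_fderiv (by norm_num)
  have h1 : Continuous fun z => fderiv ℝ G z v := h.clm_apply continuous_const
  have h2 : HasCompactSupport fun z => fderiv ℝ G z v :=
    HasCompactSupport.intro hc fun z hz => by
      have : fderiv ℝ G z = 0 := by
        by_contra h
        exact hz (support_fderiv_subset ℝ h)
      simp [this]
  have := integral_smul_fderiv_eq_neg_fderiv_smul_of_integrable (μ := (volume : Measure ℂ))
    (f := fun _ : ℂ => (1 : ℝ)) (g := G) (v := v) (by simp)
    (by simpa using h1.integrable_of_hasCompactSupport h2)
    (by simpa using hG.continuous.integrable_of_hasCompactSupport hc)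
    (fun _ _ => by fun_prop) (fun z _ => hG.differentiable (by norm_num) z)
  simpa using this

/-- Stokes' theorem for `∂̄` against a holomorphic function. -/
lemma integral_dbar_mul_eq_zero {D : Set ℂ} (hD : IsOpen D) {F : ℂ → ℂ}
    (hF : DifferentiableOn ℂ F D) {P : ℂ → ℝ} (hP : ContDiff ℝ 1 P) (hc : HasCompactSupport P)
    (hPD : tsupport P ⊆ D) : ∫ z, dbar P z * F z = 0 := by
  set G : ℂ → ℂ := fun z => (P z : ℂ) * F z with hGdef
  have hz : ∀ z ∉ D, G =ᶠ[nhds z] fun _ => 0 := fun z hz => by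
    filter_upwards [notMem_tsupport_iff_eventuallyEq.1 fun h => hz (hPD h)] with ζ hζ
    simp [hGdef, hζ]
  have hPC : ContDiff ℝ 1 fun z => (P z : ℂ) := Complex.ofRealCLM.contDiff.comp hP
  have hG : ContDiff ℝ 1 G := by
    refine contDiff_iff_contDiffAt.2 fun z => ?_
    by_cases hzD : z ∈ D
    · refine hPC.contDiffAt.mul ?_
      exact ((hF.analyticAt (hD.mem_nhds hzD)).contDiffAt).restrict_scalars ℝ
    · exact contDiffAt_const.congr_of_eventuallyEq (hz z hzD)
  have hGc : HasCompactSupport G := HasCompactSupport.intro hc fun z hz => by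
    simp [hGdef, image_eq_zero_of_notMem_tsupport hz]
  have key : ∀ z, fderiv ℝ G z 1 + Complex.I * fderiv ℝ G z Complex.I = dbar P z * F z := by
    intro z
    by_cases hzD : z ∈ D
    · have h1 : HasFDerivAt (fun z => (P z : ℂ)) (Complex.ofRealCLM.comp (fderiv ℝ P z)) z :=
        Complex.ofRealCLM.hasFDerivAt.comp z (hP.differentiable (by norm_num) z).hasFDerivAt
      have h2 := ((hF.differentiableAt (hD.mem_nhds hzD)).hasFDerivAt).restrictScalars ℝ
      have h4 : fderiv ℝ G z = _ := (h1.mul h2).fderiv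
      rw [h4]
      have h3 : fderiv ℂ F z Complex.I = Complex.I * deriv F z := by
        rw [← fderiv_apply_one_eq_deriv, ← smul_eq_mul, ← map_smul, smul_eq_mul, mul_one]
      simp [dbar, h3]
      linear_combination (P z : ℂ) * deriv F z * Complex.I_mul_I
    · rw [(hz z hzD).fderiv_eq, dbar_eq_zero_of_notMem_tsupport fun h => hzD (hPD h)]
      simp
  have hi : ∀ v, Integrable fun z => fderiv ℝ G z v := fun v => by
    refine Continuous.integrable_of_hasCompactSupport
      ((hG.continuous_fderiv (by norm_num)).clm_apply continuous_const)
      (HasCompactSupport.intro hGc fun z hz => ?_)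
    have : fderiv ℝ G z = 0 := by
      by_contra h
      exact hz (support_fderiv_subset ℝ h)
    simp [this]
  simp_rw [← key]
  rw [integral_add (hi 1) ((hi _).const_mul _), integral_const_mul,
    integral_fderiv_eq_zero hG hGc, integral_fderiv_eq_zero hG hGc]
  simp

lemma integral_dbar_mul_eq_zero_of_cutoffs {D K S : Set ℂ} (hD : IsOpen D) {F : ℂ → ℂ}
    (hF : DifferentiableOn ℂ F D) {η : ℂ → ℝ} (hη : ContDiff ℝ 1 η)
    (hη1 : ∀ z, η z ∈ Icc (0:ℝ) 1) (hc : HasCompactSupport η)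
    (hS : IsOpen S) (hSfin : volume S ≠ ⊤) (hηS : tsupport η ⊆ S) (hSK : S \ D ⊆ K)
    (hKD : Disjoint K D) (hFS : MemLp F 2 (volume.restrict (D ∩ S)))
    {χ : ℕ → ℂ → ℝ} (hχ : ∀ n, ContDiff ℝ 1 (χ n)) (hχ1 : ∀ n z, χ n z ∈ Icc (0:ℝ) 1)
    (hχK : ∀ n, ∀ a ∈ K, ∀ᶠ z in nhds a, χ n z = 1)
    (hχ0 : ∀ z ∉ K, ∀ᶠ n in atTop, χ n z = 0)
    (hχE : Tendsto (fun n => ∫⁻ z in S, ‖fderiv ℝ (χ n) z‖ₑ ^ 2) atTop (nhds 0)) :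
    ∫ z in D ∩ S, dbar η z * F z = 0 := by
  set B := D ∩ S with hB
  have hBm : MeasurableSet B := (hD.inter hS).measurableSet
  have : IsFiniteMeasure (volume.restrict B) :=
    ⟨by
      rw [Measure.restrict_apply_univ]
      exact (measure_mono inter_subset_right).trans_lt hSfin.lt_top⟩
  have hFi : Integrable F (volume.restrict B) := hFS.integrable (by norm_num)
  have hcd := continuous_dbar hη
  obtain ⟨C, hC⟩ := hcd.bounded_above_of_compact_support (hasCompactSupport_dbar hc)
  have hC0 : 0 ≤ C := (norm_nonneg _).trans (hC 0)
  have hi1 : ∀ n, Integrable (fun z => ((1 - χ n z : ℝ) : ℂ) * dbar η z * F z)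
      (volume.restrict B) := fun n => by
    refine hFi.bdd_mul (c := 1 * C) ?_ (Eventually.of_forall fun z => ?_)
    · have := (hχ n).continuous
      exact Continuous.aestronglyMeasurable (by fun_prop)
    · rw [norm_mul, Complex.norm_real]
      gcongr
      · have := hχ1 n z
        rw [Real.norm_eq_abs, abs_le]; constructor <;> linarith [this.1, this.2]
      · exact hC z
  have hi2 : ∀ n, Integrable (fun z => (η z : ℂ) * dbar (χ n) z * F z)
      (volume.restrict B) := fun n => by
    have h1 : Continuous fun z => (η z : ℂ) * dbar (χ n) z := by
      have := hη.continuous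
      have := continuous_dbar (hχ n)
      fun_prop
    obtain ⟨C', hC'⟩ := h1.bounded_above_of_compact_support
      (HasCompactSupport.intro hc fun z hz => by simp [image_eq_zero_of_notMem_tsupport hz])
    exact hFi.bdd_mul (c := C') h1.aestronglyMeasurable (Eventually.of_forall hC')
  have heq : ∀ n, ∫ z in B, ((1 - χ n z : ℝ) : ℂ) * dbar η z * F z =
      ∫ z in B, (η z : ℂ) * dbar (χ n) z * F z := by
    intro n
    have hPt : tsupport (fun z => (1 - χ n z) * η z) ⊆ tsupport η :=
      closure_mono fun z hz h => hz (by simp [h])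
    have hPD : tsupport (fun z => (1 - χ n z) * η z) ⊆ D := by
      intro z hz
      by_contra hzD
      refine (notMem_tsupport_iff_eventuallyEq.2 ?_) hz
      filter_upwards [hχK n z (hSK ⟨hηS (hPt hz), hzD⟩)] with ζ hζ
      simp [hζ]
    have h0 := integral_dbar_mul_eq_zero hD hF
      (P := fun z => (1 - χ n z) * η z) ((contDiff_const.sub (hχ n)).mul hη)
      (hc.of_isClosed_subset (isClosed_tsupport _) hPt) hPD
    rw [← setIntegral_eq_integral_of_forall_compl_eq_zero (s := B) fun z hz => ?_] at h0
    · simp_rw [dbar_one_sub_mul (hχ n) hη, sub_mul] at h0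
      rwa [integral_sub (hi1 n) (hi2 n), sub_eq_zero] at h0
    · rw [dbar_eq_zero_of_notMem_tsupport fun h => hz ⟨hPD h, hηS (hPt h)⟩, zero_mul]
  have hlim1 : Tendsto (fun n => ∫ z in B, ((1 - χ n z : ℝ) : ℂ) * dbar η z * F z) atTop
      (nhds (∫ z in B, dbar η z * F z)) := by
    refine tendsto_integral_of_dominated_convergence (fun z => C * ‖F z‖)
      (fun n => (hi1 n).aestronglyMeasurable) (hFi.norm.const_mul C)
      (fun n => Eventually.of_forall fun z => ?_) ?_
    · rw [norm_mul, norm_mul, Complex.norm_real]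
      have := hχ1 n z
      have h1 : ‖1 - χ n z‖ ≤ 1 := by
        rw [Real.norm_eq_abs, abs_le]; constructor <;> linarith [this.1, this.2]
      gcongr
      calc ‖1 - χ n z‖ * ‖dbar η z‖ ≤ 1 * C := by gcongr; exact hC z
        _ = C := one_mul C
    · filter_upwards [ae_restrict_mem hBm] with z hz
      refine tendsto_const_nhds.congr' ?_
      filter_upwards [hχ0 z fun h => (disjoint_left.1 hKD h) hz.1] with n hn
      simp [hn]
  have hlim2 : Tendsto (fun n => ∫ z in B, (η z : ℂ) * dbar (χ n) z * F z) atTop (nhds 0) := by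
    have hFfin : (∫⁻ z in B, ‖F z‖ₑ ^ (2:ℝ)) ^ (1 / 2 : ℝ) ≠ ⊤ := by
      have := hFS.eLpNorm_lt_top
      rw [eLpNorm_eq_lintegral_rpow_enorm_toReal (by norm_num) (by norm_num)] at this
      simpa using this.ne
    have hb : ∀ n, ‖∫ z in B, (η z : ℂ) * dbar (χ n) z * F z‖ₑ ≤
        (2 * (∫⁻ z in S, ‖fderiv ℝ (χ n) z‖ₑ ^ 2) ^ (1 / 2 : ℝ)) *
          (∫⁻ z in B, ‖F z‖ₑ ^ (2:ℝ)) ^ (1 / 2 : ℝ) := by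
      intro n
      have hm : Continuous fun z => ‖fderiv ℝ (χ n) z‖ₑ :=
        ((hχ n).continuous_fderiv (by norm_num)).enorm
      calc ‖∫ z in B, (η z : ℂ) * dbar (χ n) z * F z‖ₑ
          ≤ ∫⁻ z in B, ‖(η z : ℂ) * dbar (χ n) z * F z‖ₑ := enorm_integral_le_lintegral_enorm _
        _ ≤ ∫⁻ z in B, 2 * ((fun z => ‖fderiv ℝ (χ n) z‖ₑ) * fun z => ‖F z‖ₑ) z := by
            refine lintegral_mono fun z => ?_
            rw [enorm_mul, Pi.mul_apply, ← mul_assoc]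
            gcongr
            rw [← ofReal_norm, ← ofReal_norm, show (2 : ENNReal) = ENNReal.ofReal 2 by simp,
              ← ENNReal.ofReal_mul (by norm_num)]
            refine ENNReal.ofReal_le_ofReal ?_
            rw [norm_mul, Complex.norm_real, Real.norm_of_nonneg (hη1 z).1]
            calc η z * ‖dbar (χ n) z‖ ≤ 1 * (2 * ‖fderiv ℝ (χ n) z‖) := by
                  gcongr
                  · exact (hη1 z).2
                  · exact norm_dbar_le _ _
              _ = _ := one_mul _
        _ = 2 * ∫⁻ z in B, ((fun z => ‖fderiv ℝ (χ n) z‖ₑ) * fun z => ‖F z‖ₑ) z :=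
            lintegral_const_mul' _ _ (by norm_num)
        _ ≤ 2 * ((∫⁻ z in B, ‖fderiv ℝ (χ n) z‖ₑ ^ (2:ℝ)) ^ (1 / 2 : ℝ) *
            (∫⁻ z in B, ‖F z‖ₑ ^ (2:ℝ)) ^ (1 / 2 : ℝ)) := by
            gcongr
            exact ENNReal.lintegral_mul_le_Lp_mul_Lq _ Real.HolderConjugate.two_two
              hm.measurable.aemeasurable hFi.aestronglyMeasurable.enorm
        _ ≤ _ := by
            rw [← mul_assoc]
            simp only [ENNReal.rpow_two]
            gcongr
            exact inter_subset_right
    rw [tendsto_zero_iff_enorm_tendsto_zero]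
    refine tendsto_of_tendsto_of_tendsto_of_le_of_le tendsto_const_nhds ?_
      (fun _ => zero_le) hb
    have h1 := (hχE.ennrpow_const (1 / 2 : ℝ))
    rw [ENNReal.zero_rpow_of_pos (by norm_num)] at h1
    have h2 := ENNReal.Tendsto.const_mul (a := 2) h1 (Or.inr (by norm_num))
    have h3 := ENNReal.Tendsto.mul_const h2 (Or.inr hFfin)
    simpa using h3
  simp_rw [heq] at hlim1
  exact tendsto_nhds_unique hlim1 hlim2

lemma exists_radial_cutoff (z₀ : ℂ) {r : ℝ} (hr : 0 < r) :
    ∃ η κ : ℂ → ℝ, ContDiff ℝ 1 η ∧ (∀ z, η z ∈ Icc (0:ℝ) 1) ∧ HasCompactSupport η ∧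
      tsupport η ⊆ ball z₀ r ∧ Continuous κ ∧ (∃ s > 0, ∀ z ∈ ball z₀ s, κ z = 0) ∧
      (∀ z, 0 ≤ κ z) ∧ (∃ z ∈ ball z₀ r, κ z ≠ 0) ∧
      ∀ z, dbar η z = -κ z * (z - z₀) := by
  set s := r / 2 with hs
  have hs0 : 0 < s := by positivity
  set e : ℂ → ℝ := fun ζ => 2 - (s ^ 2)⁻¹ * ‖ζ - z₀‖ ^ 2 with he
  set η : ℂ → ℝ := fun ζ => Real.smoothTransition (e ζ) with hη
  set κ : ℂ → ℝ := fun ζ => 2 * (s ^ 2)⁻¹ * deriv Real.smoothTransition (e ζ) with hκ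
  have hec : Continuous e := by simp only [he]; fun_prop
  have hed : ∀ z, HasFDerivAt e (-((s ^ 2)⁻¹ • (2 • innerSL ℝ (z - z₀)))) z := fun z => by
    have h1 : HasFDerivAt (fun z : ℂ => ‖z - z₀‖ ^ 2) (2 • innerSL ℝ (z - z₀)) z := by
      simpa using! ((hasFDerivAt_id z).sub_const z₀).norm_sq
    exact (h1.const_mul _).const_sub 2
  have hηd : ∀ z, HasFDerivAt η (deriv Real.smoothTransition (e z) •
      -((s ^ 2)⁻¹ • (2 • innerSL ℝ (z - z₀) : ℂ →L[ℝ] ℝ))) z := fun z =>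
    (hasDerivAt_smoothTransition _).comp_hasFDerivAt z (hed z)
  have hκc : Continuous κ := continuous_const.mul (continuous_deriv_smoothTransition.comp hec)
  have hsupp : tsupport η ⊆ closedBall z₀ (3 / 2 * s) := by
    refine closure_minimal (fun z hz => ?_) isClosed_closedBall
    by_contra h
    rw [mem_closedBall, dist_eq_norm, not_le] at h
    refine hz (Real.smoothTransition.zero_of_nonpos ?_)
    have h1 : (3 / 2 * s) ^ 2 ≤ ‖z - z₀‖ ^ 2 := by gcongr
    simp only [he]
    rw [sub_nonpos, inv_mul_eq_div, le_div_iff₀ (by positivity)]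
    nlinarith
  have hcl : closedBall z₀ (3 / 2 * s) ⊆ ball z₀ r := closedBall_subset_ball (by linarith)
  refine ⟨η, κ, ?_, fun z => ⟨Real.smoothTransition.nonneg _, Real.smoothTransition.le_one _⟩,
    (isCompact_closedBall z₀ _).of_isClosed_subset (isClosed_tsupport _) hsupp,
    hsupp.trans hcl, hκc, ⟨s, hs0, fun z hz => ?_⟩, fun z => ?_, ?_, fun z => ?_⟩
  · refine (Real.smoothTransition.contDiff (n := 1)).comp ?_
    exact contDiff_const.sub (contDiff_const.mul ((contDiff_id.sub contDiff_const).norm_sq ℝ))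
  · have h1 : 1 < e z := by
      rw [mem_ball, dist_eq_norm] at hz
      have h1 : ‖z - z₀‖ ^ 2 < s ^ 2 := by gcongr
      have h2 : (s ^ 2)⁻¹ * ‖z - z₀‖ ^ 2 < 1 := by
        rw [inv_mul_eq_div, div_lt_one (by positivity)]; exact h1
      simp only [he]; linarith
    have h' : Real.smoothTransition =ᶠ[nhds (e z)] fun _ => 1 :=
      (eventually_gt_nhds h1).mono fun y hy => Real.smoothTransition.one_of_one_le hy.le
    simp only [hκ]
    rw [h'.deriv_eq, deriv_const, mul_zero]
  · have := Real.smoothTransition.monotone.deriv_nonneg (x := e z)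
    positivity
  · obtain ⟨t, ht, h1⟩ := exists_deriv_eq_slope Real.smoothTransition (zero_lt_one (α := ℝ))
      (Real.smoothTransition.continuous.continuousOn)
      (fun x _ => (hasDerivAt_smoothTransition x).differentiableAt.differentiableWithinAt)
    refine ⟨z₀ + (s * √(2 - t) : ℝ), ?_, ?_⟩
    · rw [mem_ball, dist_eq_norm, add_sub_cancel_left, Complex.norm_real,
        Real.norm_of_nonneg (by positivity)]
      have : √(2 - t) < 2 := by
        rw [Real.sqrt_lt' (by norm_num)]; linarith [ht.1]
      nlinarith
    · have h2 : e (z₀ + (s * √(2 - t) : ℝ)) = t := by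
        simp only [he]
        rw [add_sub_cancel_left, Complex.norm_real, Real.norm_of_nonneg (by positivity), mul_pow,
          Real.sq_sqrt (by linarith [ht.2])]
        field_simp
        ring
      simp only [hκ, h2, h1]
      simp [hs0.ne']
  · unfold dbar
    rw [(hηd z).fderiv]
    apply Complex.ext <;> simp [hκ] <;> ring

lemma memLp_dslope {D B : Set ℂ} (hD : IsOpen D) {f : ℂ → ℂ} (hf : DifferentiableOn ℂ f D)
    {z : ℂ} (hz : z ∈ D) (hBD : B ⊆ D) (hBm : MeasurableSet B) (hB : volume B ≠ ⊤)
    (hfL : MemLp f 2 (volume.restrict B)) : MemLp (dslope f z) 2 (volume.restrict B) := by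
  have : IsFiniteMeasure (volume.restrict B) :=
    ⟨by rw [Measure.restrict_apply_univ]; exact hB.lt_top⟩
  have hF := (Complex.differentiableOn_dslope (hD.mem_nhds hz)).2 hf
  obtain ⟨δ, hδ, hδD⟩ := Metric.nhds_basis_closedBall.mem_iff.1 (hD.mem_nhds hz)
  obtain ⟨C, hC⟩ := (isCompact_closedBall z δ).exists_bound_of_continuousOn
    (hF.continuousOn.mono hδD)
  have hC0 : 0 ≤ C := (norm_nonneg _).trans (hC z (mem_closedBall_self hδ.le))
  refine MemLp.mono' (g := fun ζ => C + δ⁻¹ * (‖f ζ‖ + ‖f z‖))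
    ((memLp_const C).add ((hfL.norm.add (memLp_const ‖f z‖)).const_mul δ⁻¹))
    ((hF.continuousOn.mono hBD).aestronglyMeasurable hBm) ?_
  refine Eventually.of_forall fun ζ => ?_
  by_cases h : ζ ∈ closedBall z δ
  · exact (hC ζ h).trans (le_add_of_nonneg_right (by positivity))
  · rw [mem_closedBall, dist_eq_norm, not_le] at h
    have hne : ζ ≠ z := by rintro rfl; simp at h; linarith
    rw [dslope_of_ne _ hne, slope_def_field, norm_div, div_eq_inv_mul]
    refine le_add_of_nonneg_of_le hC0 ?_
    gcongr
    exact norm_sub_le _ _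

lemma not_isL2hDomainOfHolomorphy_of_cutoffs {D K : Set ℂ} (hD : IsOpen D) {z₀ : ℂ} {r : ℝ}
    (hr : 0 < r) (hz₀ : z₀ ∉ D)
    (hdense : ∀ O : Set ℂ, IsOpen O → (O ∩ ball z₀ r).Nonempty → (O ∩ ball z₀ r ∩ D).Nonempty)
    (hSK : ball z₀ r \ D ⊆ K) (hKD : Disjoint K D)
    {χ : ℕ → ℂ → ℝ} (hχ : ∀ n, ContDiff ℝ 1 (χ n)) (hχ1 : ∀ n z, χ n z ∈ Icc (0:ℝ) 1)
    (hχK : ∀ n, ∀ a ∈ K, ∀ᶠ z in nhds a, χ n z = 1)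
    (hχ0 : ∀ z ∉ K, ∀ᶠ n in atTop, χ n z = 0)
    (hχE : Tendsto (fun n => ∫⁻ z in ball z₀ r, ‖fderiv ℝ (χ n) z‖ₑ ^ 2) atTop (nhds 0)) :
    ¬ IsL2hDomainOfHolomorphy D := by
  obtain ⟨η, κ, hη, hη1, hηc, hηS, hκ, ⟨s, hs, hκs⟩, hκ0, ⟨z₁, hz₁, hκ1⟩, hdb⟩ :=
    exists_radial_cutoff z₀ hr
  set S := ball z₀ r
  set B := D ∩ S with hB
  have hBo : IsOpen B := hD.inter isOpen_ball
  have hBfin : volume B ≠ ⊤ := ((measure_mono inter_subset_right).trans_lt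
    measure_ball_lt_top).ne
  have : IsFiniteMeasure (volume.restrict B) :=
    ⟨by rw [Measure.restrict_apply_univ]; exact hBfin.lt_top⟩
  have hcd := continuous_dbar hη
  obtain ⟨C, hC⟩ := hcd.bounded_above_of_compact_support (hasCompactSupport_dbar hηc)
  have hdbs : ∀ z ∈ ball z₀ s, dbar η z = 0 := fun z hz => by rw [hdb, hκs z hz]; simp
  have hsep : ∀ m : ℂ → ℂ, ∀ z ∈ ball z₀ s, ∃ δ > 0, ∀ᵐ ζ ∂(volume.restrict B),
      dbar η ζ * m ζ = 0 ∨ δ ≤ ‖ζ - z‖ := by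
    intro m z hz
    obtain ⟨δ, hδ, h⟩ := Metric.isOpen_iff.1 isOpen_ball z hz
    refine ⟨δ, hδ, Eventually.of_forall fun ζ => ?_⟩
    by_contra! hcon
    refine hcon.1 ?_
    rw [hdbs ζ (h (by rw [mem_ball, dist_eq_norm]; exact hcon.2)), zero_mul]
  set w : ℂ → ℂ := fun z => ∫ ζ in B, dbar η ζ * 1 * (ζ - z)⁻¹ with hw
  have hi1 : ∀ m : ℂ → ℂ, Integrable m (volume.restrict B) →
      Integrable (fun ζ => dbar η ζ * m ζ) (volume.restrict B) := fun m hm =>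
    hm.bdd_mul (c := C) hcd.aestronglyMeasurable (Eventually.of_forall hC)
  have hi2 : ∀ m : ℂ → ℂ, Integrable m (volume.restrict B) → ∀ z ∈ ball z₀ s,
      Integrable (fun ζ => dbar η ζ * m ζ * (ζ - z)⁻¹) (volume.restrict B) := by
    intro m hm z hz
    obtain ⟨δ, hδ, h⟩ := hsep m z hz
    refine Integrable.mono' ((hi1 m hm).norm.mul_const δ⁻¹)
      ((hi1 m hm).aestronglyMeasurable.mul
        ((measurable_id.sub_const z).inv.aestronglyMeasurable)) ?_
    filter_upwards [h] with ζ hζ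
    rcases hζ with h0 | h0
    · simp [h0]
    · rw [norm_mul, norm_inv]
      gcongr
  have hwd : DifferentiableOn ℂ w (ball z₀ s) :=
    differentiableOn_cauchyIntegral (hi1 _ (integrable_const 1)) measurable_id (hsep _)
  have hw0 : w z₀ ≠ 0 := by
    have h1 : w z₀ = -((∫ ζ in B, κ ζ : ℝ) : ℂ) := by
      simp only [hw]
      rw [← integral_complex_ofReal, ← integral_neg]
      refine integral_congr_ae (Eventually.of_forall fun ζ => ?_)
      by_cases h : ζ = z₀
      · subst h; simp [hκs ζ (mem_ball_self hs)]
      · have : ζ - z₀ ≠ 0 := sub_ne_zero.2 h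
        simp only [hdb]; field_simp
    rw [h1, neg_ne_zero, Complex.ofReal_ne_zero]
    have hpos : 0 < ∫ ζ in B, κ ζ := by
      have hi : IntegrableOn κ B :=
        (hκ.continuousOn.integrableOn_compact (isCompact_closedBall z₀ r)).mono_set
          (inter_subset_right.trans ball_subset_closedBall)
      rw [setIntegral_pos_iff_support_of_nonneg_ae (Eventually.of_forall hκ0) hi]
      have ho : IsOpen (Function.support κ) := isOpen_ne_fun hκ continuous_const
      refine (ho.inter hBo).measure_pos volume ?_
      obtain ⟨y, hy, hyD⟩ := hdense _ ho ⟨z₁, hκ1, hz₁⟩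
      exact ⟨y, hy.1, hyD, hy.2⟩
    exact hpos.ne'
  obtain ⟨t, ht, htw⟩ : ∃ t > 0, ball z₀ t ⊆ ball z₀ s ∩ ball z₀ r ∩ {z | w z ≠ 0} := by
    refine Metric.mem_nhds_iff.1
      (inter_mem (inter_mem (ball_mem_nhds _ hs) (ball_mem_nhds _ hr)) ?_)
    exact (hwd.continuousOn.continuousAt (ball_mem_nhds _ hs)).eventually_ne hw0
  obtain ⟨y, hy, hyD⟩ := hdense _ (isOpen_ball (x := z₀) (ε := t))
    ⟨z₀, mem_ball_self ht, mem_ball_self hr⟩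
  obtain ⟨τ, hτ, hτD⟩ := Metric.isOpen_iff.1 ((isOpen_ball (x := z₀) (ε := t)).inter hD) y
    ⟨hy.1, hyD⟩
  rw [IsL2hDomainOfHolomorphy, not_not]
  refine ⟨ball y τ, ball z₀ t, isOpen_ball, isConnected_ball hτ, isOpen_ball,
    isConnected_ball ht, hτD, fun h => hz₀ (h (mem_ball_self ht)), fun f hf => ?_⟩
  have hfB : MemLp f 2 (volume.restrict B) := by
    rw [memLp_two_iff_integrable_sq_norm]
    · exact hf.2.mono_set inter_subset_left
    · exact (hf.1.continuousOn.mono inter_subset_left).aestronglyMeasurable hBo.measurableSet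
  have hfi := hfB.integrable (by norm_num)
  refine ⟨fun z => (∫ ζ in B, dbar η ζ * f ζ * (ζ - z)⁻¹) / w z, ?_, fun z hz => ?_⟩
  · refine DifferentiableOn.div ?_ (hwd.mono fun z hz => (htw hz).1.1) fun z hz => (htw hz).2
    exact (differentiableOn_cauchyIntegral (hi1 _ hfi) measurable_id (hsep _)).mono
      fun z hz => (htw hz).1.1
  · have hzs := (htw (hτD hz).1).1.1
    have hzD := (hτD hz).2
    have h0 := integral_dbar_mul_eq_zero_of_cutoffs hD
      ((Complex.differentiableOn_dslope (hD.mem_nhds hzD)).2 hf.1) hη hη1 hηc isOpen_ball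
      measure_ball_lt_top.ne hηS hSK hKD (memLp_dslope hD hf.1 hzD inter_subset_left
        hBo.measurableSet hBfin hfB) hχ hχ1 hχK hχ0 hχE
    have h1 : ∀ ζ, dbar η ζ * dslope f z ζ =
        dbar η ζ * f ζ * (ζ - z)⁻¹ - f z * (dbar η ζ * 1 * (ζ - z)⁻¹) := by
      intro ζ
      by_cases h : ζ = z
      · subst h; simp [hdbs ζ hzs]
      · rw [dslope_of_ne _ h, slope_def_field]
        ring
    simp_rw [h1] at h0
    rw [integral_sub (hi2 _ hfi z hzs) ((hi2 _ (integrable_const 1) z hzs).const_mul _),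
      integral_const_mul, sub_eq_zero] at h0
    simp only
    rw [h0]
    exact mul_div_cancel_right₀ _ (htw (hτD hz).1).2

theorem IsL2hDomainOfHolomorphy.not_polarSet {D : Set ℂ} (h : IsL2hDomainOfHolomorphy D)
    (hD : IsOpen D) {U : Set ℂ} (hU : IsOpen U) (hne : (U \ D).Nonempty) : ¬ PolarSet (U \ D) := by
  rintro ⟨Ω, hUΩ, u, hu, hbot⟩
  obtain ⟨z₀, hz₀, hz₀D⟩ := hne
  obtain ⟨ρ, hρ, hρU⟩ := Metric.nhds_basis_closedBall.mem_iff.1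
    ((hU.inter hu.1).mem_nhds ⟨hz₀, hUΩ ⟨hz₀, hz₀D⟩⟩)
  set r := ρ / 4 with hr
  have hr0 : 0 < r := by positivity
  have h4 : 4 * r = ρ := by rw [hr]; ring
  set K := closedBall z₀ r \ D with hK
  have hrU : closedBall z₀ r ⊆ U ∩ Ω := (closedBall_subset_closedBall (by linarith)).trans hρU
  have : CompactSpace K := isCompact_iff_compactSpace.1 ((isCompact_closedBall z₀ r).diff hD)
  have : Nonempty K := ⟨⟨z₀, mem_closedBall_self hr0.le, hz₀D⟩⟩
  have hlarge := (bounded_potential_or_large (K := K)).resolve_left fun ⟨μ, M, hM⟩ =>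
    not_bounded_potential_of_bot (μ : Measure K) hu hr0 sdiff_subset
      (by rw [h4]; exact fun z hz => (hρU hz).2) (fun z hz => hbot z ⟨(hrU hz.1).1, hz.2⟩) hM
  obtain ⟨χ, hχ, hχ1, hχK, hχ0, hχE⟩ := exists_cutoffs (K := K) (c := z₀) (R := 2 * r)
    (sdiff_subset.trans (closedBall_subset_ball (by linarith))) hlarge
  refine not_isL2hDomainOfHolomorphy_of_cutoffs hD hr0 hz₀D ?_
    (sdiff_subset_sdiff_left ball_subset_closedBall) disjoint_sdiff_left hχ hχ1 hχK hχ0 ?_ h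
  · rintro O hO ⟨y, hy⟩
    obtain ⟨t, ht, htO⟩ := Metric.isOpen_iff.1 (hO.inter isOpen_ball) y hy
    have htU : ball y t ⊆ U ∩ Ω := fun z hz => hrU (ball_subset_closedBall (htO hz).2)
    obtain ⟨z, hz, hzu⟩ := exists_ne_bot_of_subharmonicOn hu ht fun z hz => (htU hz).2
    refine ⟨z, htO hz, ?_⟩
    by_contra hzD
    exact hzu (hbot z ⟨(htU hz).1, hzD⟩)
  · refine tendsto_of_tendsto_of_tendsto_of_le_of_le tendsto_const_nhds hχE
      (fun _ => zero_le) fun n => ?_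
    exact lintegral_mono_set (ball_subset_ball (by linarith))

lemma exists_forall_le_norm_sub {K : Set ℂ} [CompactSpace K] {z : ℂ} (hz : z ∉ K) :
    ∃ δ > 0, ∀ w ∈ K, δ ≤ ‖w - z‖ := by
  obtain ⟨δ, hδ, h⟩ := Metric.isOpen_iff.1 (isClosed_of_compactSpace K).isOpen_compl z hz
  refine ⟨δ, hδ, fun w hw => ?_⟩
  by_contra! hlt
  exact h (by rwa [mem_ball, dist_eq_norm]) hw

lemma inv_norm_sub_le_invKer {δ ε : ℝ} (hδ : 0 < δ) (hε : 0 < ε) (hεδ : ε ≤ δ) {z w : ℂ}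
    (h : δ ≤ ‖w - z‖) : ‖w - z‖⁻¹ ≤ 2 * invKer ε z w := by
  unfold invKer
  rw [norm_sub_rev z w]
  have h0 : 0 < ‖w - z‖ := hδ.trans_le h
  have h1 : √(‖w - z‖ ^ 2 + ε ^ 2) ≤ 2 * ‖w - z‖ := by
    refine Real.sqrt_le_iff.2 ⟨by positivity, ?_⟩
    nlinarith
  have h2 : 0 < √(‖w - z‖ ^ 2 + ε ^ 2) := Real.sqrt_pos.2 (by positivity)
  rw [← div_eq_mul_inv, inv_eq_one_div, div_le_div_iff₀ h0 h2]
  linarith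

section CauchyIntegral

variable {K : Set ℂ} [CompactSpace K] {μ : Measure K}

lemma integrable_mul_inv_sub {h : K → ℂ} (hh : Integrable h μ) {z : ℂ} (hz : z ∉ K) :
    Integrable (fun w : K => h w * ((w : ℂ) - z)⁻¹) μ := by
  obtain ⟨δ, hδ, hd⟩ := exists_forall_le_norm_sub hz
  refine Integrable.mono' (hh.norm.mul_const δ⁻¹) (hh.aestronglyMeasurable.mul
    ((measurable_subtype_coe.sub_const z).inv.aestronglyMeasurable)) ?_
  refine Eventually.of_forall fun w => ?_
  rw [norm_mul, norm_inv]
  gcongr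
  exact hd w w.2

variable [IsProbabilityMeasure μ]

lemma lintegral_sq_cauchyIntegral_lt_top {D : Set ℂ} (hKD : Disjoint K D) {c : ℂ}
    {R M H : ℝ} (hK : K ⊆ ball c R) (hM : ∀ ε > 0, ∀ z, logPot ε μ z ≤ M) {h : K → ℂ}
    (hH : ∀ w, ‖h w‖ ≤ H) (hD : IsOpen D) :
    ∫⁻ z in D ∩ ball c R, ‖∫ w : K, h w * ((w : ℂ) - z)⁻¹ ∂μ‖ₑ ^ 2 < ⊤ := by
  set ε : ℕ → ℝ := fun n => 1 / ((n : ℝ) + 1) with hε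
  have hε0 : ∀ n, 0 < ε n := fun n => by positivity
  have hε1 : ∀ n, ε n ≤ 1 := fun n => by
    simp only [hε]; rw [div_le_one (by positivity)]; linarith [n.cast_nonneg (α := ℝ)]
  set I : ℕ → ℂ → ENNReal := fun n z => ∫⁻ w : K, ENNReal.ofReal (invKer (ε n) z w) ∂μ with hI
  set A : ENNReal := ENNReal.ofReal (2 * H) with hA
  have hIm : ∀ n, Measurable (I n) := fun n => by
    have : I n = fun z => ENNReal.ofReal (∫ w : K, invKer (ε n) z w ∂μ) := funext fun z =>
      (ofReal_integral_eq_lintegral_ofReal (integrable_invKer μ (hε0 n) z)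
        (Eventually.of_forall fun w => invKer_nonneg _ _ _)).symm
    rw [this]
    exact (continuous_integral_invKer μ (hε0 n)).measurable.ennreal_ofReal
  have hb : ∀ n, ∫⁻ z in D ∩ ball c R, (A * I n z) ^ 2 ≤
      A ^ 2 * ENNReal.ofReal (energyConst R + 4 * Real.pi * M) := fun n => by
    simp only [mul_pow]
    rw [lintegral_const_mul' _ _ (by finiteness)]
    gcongr
    refine (lintegral_mono_set inter_subset_right).trans
      ((lintegral_sq_invKer_le μ (hε0 n) (hε1 n) hK).trans ?_)
    gcongr
    calc ∫ z : K, logPot (ε n) μ z ∂μ ≤ ∫ z : K, M ∂μ := by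
          refine integral_mono (continuous_integrable_of_compactSpace μ
            ((continuous_logPot (hε0 n) μ).comp continuous_subtype_val)) (integrable_const _) ?_
          exact fun z => hM _ (hε0 n) _
      _ = M := by simp
  have hlim : Tendsto ε atTop (nhds 0) := tendsto_one_div_add_atTop_nhds_zero_nat
  calc ∫⁻ z in D ∩ ball c R, ‖∫ w : K, h w * ((w : ℂ) - z)⁻¹ ∂μ‖ₑ ^ 2
      ≤ ∫⁻ z in D ∩ ball c R, liminf (fun n => (A * I n z) ^ 2) atTop := by
        refine setLIntegral_mono' (hD.inter isOpen_ball).measurableSet fun z hz => ?_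
        obtain ⟨δ, hδ, hd⟩ := exists_forall_le_norm_sub (disjoint_right.1 hKD hz.1)
        refine le_liminf_of_le (by isBoundedDefault) ?_
        filter_upwards [hlim.eventually_lt_const hδ] with n hn
        gcongr
        refine (enorm_integral_le_lintegral_enorm _).trans ?_
        simp only [hI, hA]
        rw [← lintegral_const_mul' _ _ (by finiteness)]
        refine lintegral_mono fun w => ?_
        have hH0 : 0 ≤ H := (norm_nonneg _).trans (hH w)
        rw [← ofReal_norm, ← ENNReal.ofReal_mul (by positivity), norm_mul, norm_inv]
        refine ENNReal.ofReal_le_ofReal ?_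
        calc ‖h w‖ * ‖(w : ℂ) - z‖⁻¹ ≤ H * (2 * invKer (ε n) z w) := by
              gcongr
              · exact hH w
              · exact inv_norm_sub_le_invKer hδ (hε0 n) hn.le (hd w w.2)
          _ = _ := by ring
    _ ≤ liminf (fun n => ∫⁻ z in D ∩ ball c R, (A * I n z) ^ 2) atTop :=
        lintegral_liminf_le fun n => ((hIm n).const_mul A).pow_const 2
    _ ≤ A ^ 2 * ENNReal.ofReal (energyConst R + 4 * Real.pi * M) :=
        liminf_le_of_le (by isBoundedDefault) fun b hb' => by
          obtain ⟨n, hn⟩ := hb'.exists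
          exact hn.trans (hb n)
    _ < ⊤ := by finiteness

lemma norm_cauchyIntegral_le {c : ℂ} {R H : ℝ} (hR : 0 < R) (hK : K ⊆ ball c R)
    {h : K → ℂ} (hh : Integrable h μ) (hH : ∀ w, ‖h w‖ ≤ H) (h0 : ∫ w, h w ∂μ = 0) {z : ℂ}
    (hz : 2 * R ≤ ‖z - c‖) :
    ‖∫ w : K, h w * ((w : ℂ) - z)⁻¹ ∂μ‖ ≤ 2 * H * R / ‖z - c‖ ^ 2 := by
  have hzK : z ∉ K := fun h => by
    have := hK h
    rw [mem_ball, dist_eq_norm] at this; linarith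
  have h1 : ∫ w : K, h w * ((w : ℂ) - z)⁻¹ ∂μ =
      ∫ w : K, (h w * ((w : ℂ) - z)⁻¹ - h w * (c - z)⁻¹) ∂μ := by
    rw [integral_sub (integrable_mul_inv_sub hh hzK) (hh.mul_const _), integral_mul_const, h0]
    simp
  have hzc : 0 < ‖z - c‖ := by linarith
  rw [h1]
  refine (norm_integral_le_of_norm_le_const (Eventually.of_forall fun w => ?_)).trans_eq
    (by rw [probReal_univ, mul_one])
  have hw : ‖(w : ℂ) - c‖ ≤ R := by
    have := hK w.2
    rw [mem_ball, dist_eq_norm] at this; exact this.le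
  have hwz : ‖z - c‖ / 2 ≤ ‖(w : ℂ) - z‖ := by
    have := norm_sub_norm_le (z - c) (w - c)
    rw [sub_sub_sub_cancel_right, norm_sub_rev z (w : ℂ)] at this
    linarith
  have hne : (w : ℂ) - z ≠ 0 := norm_pos_iff.1 (by linarith)
  have hne' : c - z ≠ 0 := by rw [← norm_pos_iff, norm_sub_rev]; exact hzc
  have hH0 : 0 ≤ H := (norm_nonneg _).trans (hH w)
  have e : h w * ((w : ℂ) - z)⁻¹ - h w * (c - z)⁻¹ =
      h w * (c - w) * (((w : ℂ) - z)⁻¹ * (c - z)⁻¹) := by field_simp; ring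
  rw [e, norm_mul, norm_mul, norm_mul, norm_inv, norm_inv, norm_sub_rev c w, norm_sub_rev c z]
  calc ‖h w‖ * ‖(w : ℂ) - c‖ * (‖(w : ℂ) - z‖⁻¹ * ‖z - c‖⁻¹)
      ≤ H * R * ((‖z - c‖ / 2)⁻¹ * ‖z - c‖⁻¹) := by
        gcongr
        exact hH w
    _ = _ := by field_simp

lemma cauchyIntegral_mem_L2h {D : Set ℂ} (hD : IsOpen D) (hKD : Disjoint K D) {c : ℂ}
    {R M : ℝ} (hR : 1 ≤ R) (hK : K ⊆ ball c R) (hM : ∀ ε > 0, ∀ z, logPot ε μ z ≤ M)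
    {h : K → ℂ} (hh : Continuous h) (h0 : ∫ w, h w ∂μ = 0) :
    (fun z => ∫ w : K, h w * ((w : ℂ) - z)⁻¹ ∂μ) ∈ L2h D := by
  set F : ℂ → ℂ := fun z => ∫ w : K, h w * ((w : ℂ) - z)⁻¹ ∂μ with hF
  have hi := continuous_integrable_of_compactSpace μ hh
  obtain ⟨H, hH⟩ := isCompact_univ.exists_bound_of_continuousOn hh.continuousOn
  replace hH : ∀ w, ‖h w‖ ≤ H := fun w => hH w (mem_univ w)
  have hdiff : DifferentiableOn ℂ F D :=
    differentiableOn_cauchyIntegral hi measurable_subtype_coe fun z hz => by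
      obtain ⟨δ, hδ, hd⟩ := exists_forall_le_norm_sub (disjoint_right.1 hKD hz)
      exact ⟨δ, hδ, Eventually.of_forall fun w => Or.inr (hd w w.2)⟩
  have hcont : ContinuousOn (fun z => ‖F z‖ ^ 2) D := hdiff.continuousOn.norm.pow 2
  refine ⟨hdiff, ?_⟩
  have hsplit : D = D ∩ ball c (2 * R) ∪ D \ ball c (2 * R) := (inter_union_sdiff _ _).symm
  rw [hsplit]
  refine IntegrableOn.union ?_ ?_
  · refine ⟨(hcont.mono inter_subset_left).aestronglyMeasurable
      (hD.inter isOpen_ball).measurableSet, ?_⟩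
    have := lintegral_sq_cauchyIntegral_lt_top (μ := μ) hKD
      (hK.trans (ball_subset_ball (by linarith : R ≤ 2 * R))) hM hH hD
    rw [hasFiniteIntegral_iff_enorm]
    simpa [enorm_pow] using this
  · have hIntegrable : Integrable fun z : ℂ => (2 * H * R) ^ 2 * 16 * (1 + ‖z - c‖) ^ (-(4:ℝ)) :=
      ((integrable_one_add_norm (E := ℂ) (μ := volume) (r := 4)
        (by rw [Complex.finrank_real_complex]; norm_num)).comp_sub_right c).const_mul _
    refine Integrable.mono' hIntegrable.integrableOn ((hcont.mono sdiff_subset).aestronglyMeasurable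
      (hD.measurableSet.diff measurableSet_ball)) ?_
    filter_upwards [ae_restrict_mem (hD.measurableSet.diff measurableSet_ball)] with z hz
    have hz2 : 2 * R ≤ ‖z - c‖ := by
      simpa [dist_eq_norm] using hz.2
    have hb := norm_cauchyIntegral_le (μ := μ) (by linarith) hK hi hH h0 hz2
    have hx : 1 ≤ ‖z - c‖ := by linarith
    rw [norm_pow, norm_norm]
    calc ‖F z‖ ^ 2 ≤ (2 * H * R / ‖z - c‖ ^ 2) ^ 2 := by gcongr
      _ = (2 * H * R) ^ 2 * (‖z - c‖ ^ 4)⁻¹ := by rw [div_pow, div_eq_mul_inv]; ring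
      _ ≤ (2 * H * R) ^ 2 * (16 * (1 + ‖z - c‖) ^ (-(4:ℝ))) := by
          gcongr
          rw [Real.rpow_neg (by positivity), ← div_eq_mul_inv, inv_eq_one_div,
            show (4:ℝ) = ((4:ℕ) : ℝ) by norm_num, Real.rpow_natCast,
            div_le_div_iff₀ (by positivity) (by positivity), one_mul]
          calc (1 + ‖z - c‖) ^ 4 ≤ (2 * ‖z - c‖) ^ 4 := by gcongr; linarith
            _ = _ := by ring
      _ = _ := by ring

end CauchyIntegral

section Moments

variable {K : Set ℂ} [CompactSpace K] {μ : Measure K} [IsProbabilityMeasure μ]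

lemma integral_norm_sq_sub_const {f : K → ℂ} (hf : Continuous f) (c : ℂ) :
    ∫ w, ‖f w - c‖ ^ 2 ∂μ = ∫ w, ‖f w - ∫ v, f v ∂μ‖ ^ 2 ∂μ + ‖∫ v, f v ∂μ - c‖ ^ 2 := by
  set m := ∫ v, f v ∂μ with hm
  have hi := continuous_integrable_of_compactSpace μ hf
  have h1 : ∀ w, ‖f w - c‖ ^ 2 = ‖f w - m‖ ^ 2 + ‖m - c‖ ^ 2 +
      2 * ((f w - m) * (starRingEnd ℂ) (m - c)).re := fun w => by
    rw [← sub_add_sub_cancel (f w) m c]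
    simp only [← Complex.normSq_eq_norm_sq, Complex.normSq_add]
  have hg : Integrable (fun w => (f w - m) * (starRingEnd ℂ) (m - c)) μ :=
    (hi.sub (integrable_const m)).mul_const _
  have h2 : ∫ w, ((f w - m) * (starRingEnd ℂ) (m - c)).re ∂μ = 0 := by
    have := Complex.reCLM.integral_comp_comm hg
    simp only [Complex.reCLM_apply] at this
    rw [this, integral_mul_const, integral_sub hi (integrable_const m)]
    simp [← hm]
  have h3 : Integrable (fun w => ‖f w - m‖ ^ 2) μ :=
    continuous_integrable_of_compactSpace μ (by fun_prop)
  have h4 : Integrable (fun w => ((f w - m) * (starRingEnd ℂ) (m - c)).re) μ := hg.re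
  simp_rw [h1]
  have h5 : Integrable (fun w => ‖f w - m‖ ^ 2 + ‖m - c‖ ^ 2) μ := h3.add (integrable_const _)
  rw [integral_add h5 (h4.const_mul 2), integral_add h3 (integrable_const _), integral_const_mul,
    h2]
  simp

lemma exists_moment_bound {T : ℝ} {ψ : ℕ → K → ℂ} (hψ : ∀ n, Continuous (ψ n))
    (h : ∀ f : C(K, ℂ), ∃ C, ∀ n, T ^ n * ‖∫ w, f w * ψ n w ∂μ‖ ≤ C) (hT : 0 ≤ T) :
    ∃ C, 0 ≤ C ∧ ∀ n, ∀ f : C(K, ℂ), T ^ n * ‖∫ w, f w * ψ n w ∂μ‖ ≤ C * ‖f‖ := by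
  have hi : ∀ n (f : C(K, ℂ)), Integrable (fun w => f w * ψ n w) μ := fun n f =>
    continuous_integrable_of_compactSpace μ (f.continuous.mul (hψ n))
  set Λ : ℕ → C(K, ℂ) →L[ℂ] ℂ := fun n => LinearMap.mkContinuous
    { toFun := fun f => (T : ℂ) ^ n * ∫ w, f w * ψ n w ∂μ
      map_add' := fun f g => by
        simp only [ContinuousMap.add_apply, add_mul]
        rw [integral_add (hi n f) (hi n g), mul_add]
      map_smul' := fun c f => by
        simp only [ContinuousMap.smul_apply, smul_eq_mul, mul_assoc, RingHom.id_apply]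
        rw [integral_const_mul]
        ring } (T ^ n * ∫ w, ‖ψ n w‖ ∂μ) (fun f => by
      change ‖(T : ℂ) ^ n * ∫ w, f w * ψ n w ∂μ‖ ≤ _
      rw [norm_mul, norm_pow, Complex.norm_real, Real.norm_of_nonneg hT, mul_assoc]
      gcongr
      rw [← integral_mul_const]
      refine norm_integral_le_of_norm_le
        ((continuous_integrable_of_compactSpace μ (hψ n)).norm.mul_const _)
        (Eventually.of_forall fun w => ?_)
      rw [norm_mul, mul_comm]
      gcongr
      exact f.norm_coe_le_norm w) with hΛ
  have hΛn : ∀ n f, ‖Λ n f‖ = T ^ n * ‖∫ w, f w * ψ n w ∂μ‖ := fun n f => by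
    change ‖(T : ℂ) ^ n * ∫ w, f w * ψ n w ∂μ‖ = _
    rw [norm_mul, norm_pow, Complex.norm_real, Real.norm_of_nonneg hT]
  obtain ⟨C, hC⟩ := banach_steinhaus (g := Λ) fun f => by simpa only [hΛn] using h f
  refine ⟨C, (norm_nonneg _).trans (hC 0), fun n f => ?_⟩
  rw [← hΛn]
  exact (Λ n).le_of_opNorm_le (hC n) f

lemma ae_eq_const_of_moment_bound {q : ℂ} {R R' T C : ℝ} (hR : 0 < R) (hT : 0 < T)
    (hRT : R' ^ 2 < R * T)
    (hKR : ∀ w ∈ K, R ≤ ‖w - q‖ ∧ ‖w - q‖ ≤ R') {φ : ℕ → K → ℂ}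
    (hφ : φ = fun (n : ℕ) (w : K) => (((w : ℂ) - q) ^ (n + 1))⁻¹) (hC0 : 0 ≤ C)
    (hC : ∀ n, ∀ f : C(K, ℂ),
      T ^ n * ‖∫ w, f w * (φ n w - ∫ v, φ n v ∂μ) ∂μ‖ ≤ C * ‖f‖) :
    ∀ᵐ w ∂μ, φ 0 w = ∫ v, φ 0 v ∂μ := by
  have hw0 : ∀ w : K, (w : ℂ) - q ≠ 0 := fun w =>
    norm_pos_iff.1 (hR.trans_le (hKR w w.2).1)
  have hφc : ∀ n, Continuous (φ n) := fun n => by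
    rw [hφ]
    exact Continuous.inv₀ (by fun_prop) fun w => pow_ne_zero _ (hw0 w)
  have hφle : ∀ n w, ‖φ n w‖ ≤ (R ^ (n + 1))⁻¹ := fun n w => by
    simp only [hφ, norm_inv, norm_pow]
    gcongr
    exact (hKR w w.2).1
  set m : ℕ → ℂ := fun n => ∫ v, φ n v ∂μ with hm
  set ψ : ℕ → K → ℂ := fun n w => φ n w - m n with hψ
  have hψc : ∀ n, Continuous (ψ n) := fun n => (hφc n).sub continuous_const
  have hi : ∀ {g : K → ℝ}, Continuous g → Integrable g μ := fun hg =>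
    continuous_integrable_of_compactSpace μ hg
  have hmle : ∀ n, ‖m n‖ ≤ (R ^ (n + 1))⁻¹ := fun n =>
    (norm_integral_le_of_norm_le_const (Eventually.of_forall (hφle n))).trans_eq
      (by rw [probReal_univ, mul_one])
  have hψle : ∀ n w, ‖ψ n w‖ ≤ 2 * (R ^ (n + 1))⁻¹ := fun n w =>
    (norm_sub_le _ _).trans (by linarith [hφle n w, hmle n])
  set A : ℝ := 2 * C / R with hA
  have hA0 : 0 ≤ A := by positivity
  have hvar : ∀ n, ∫ w, ‖ψ n w‖ ^ 2 ∂μ ≤ A * ((R * T) ^ n)⁻¹ := fun n => by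
    set f : C(K, ℂ) := ⟨fun w => (starRingEnd ℂ) (ψ n w), by
      have := hψc n; fun_prop⟩ with hf
    have h1 : ‖f‖ ≤ 2 * (R ^ (n + 1))⁻¹ :=
      (ContinuousMap.norm_le _ (by positivity)).2 fun w => by
        change ‖(starRingEnd ℂ) (ψ n w)‖ ≤ _
        rw [RCLike.norm_conj]; exact hψle n w
    have h2 : ∫ w, f w * (φ n w - m n) ∂μ = ((∫ w, ‖ψ n w‖ ^ 2 ∂μ : ℝ) : ℂ) := by
      rw [← integral_complex_ofReal]
      refine integral_congr_ae (Eventually.of_forall fun w => ?_)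
      change (starRingEnd ℂ) (ψ n w) * ψ n w = _
      rw [mul_comm, Complex.mul_conj, Complex.normSq_eq_norm_sq]
    have h3 := hC n f
    rw [h2, Complex.norm_real, Real.norm_of_nonneg (integral_nonneg fun w => by positivity)] at h3
    rw [mul_pow, mul_inv, hA]
    have hTn : 0 < T ^ n := pow_pos hT n
    rw [← mul_assoc, ← div_eq_mul_inv, le_div_iff₀ hTn, mul_comm]
    calc _ ≤ C * ‖f‖ := h3
      _ ≤ C * (2 * (R ^ (n + 1))⁻¹) := by gcongr
      _ = _ := by rw [pow_succ, mul_inv]; ring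
  set V := ∫ w, ‖ψ 0 w‖ ^ 2 ∂μ with hV
  have hV0 : 0 ≤ V := integral_nonneg fun w => by positivity
  have hrec : ∀ n, ‖m n‖ ^ 2 * V ≤ 2 * (A * ((R * T) ^ (n + 1))⁻¹) +
      2 * (R⁻¹ ^ 2 * (A * ((R * T) ^ n)⁻¹)) := by
    intro n
    have h1 : ∀ w, ‖m n * φ 0 w - m (n + 1)‖ ^ 2 ≤
        2 * ‖ψ (n + 1) w‖ ^ 2 + 2 * (R⁻¹ ^ 2 * ‖ψ n w‖ ^ 2) := by
      intro w
      have e : m n * φ 0 w - m (n + 1) = ψ (n + 1) w - φ 0 w * ψ n w := by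
        have : φ (n + 1) w = φ 0 w * φ n w := by
          simp only [hφ]; rw [← mul_inv]; ring
        simp only [hψ, this]; ring
      have h2 : ‖φ 0 w‖ ≤ R⁻¹ := by simpa using hφle 0 w
      have h3 : ‖m n * φ 0 w - m (n + 1)‖ ≤ ‖ψ (n + 1) w‖ + R⁻¹ * ‖ψ n w‖ := by
        rw [e]
        refine (norm_sub_le _ _).trans ?_
        rw [norm_mul]
        gcongr
      calc _ ≤ (‖ψ (n + 1) w‖ + R⁻¹ * ‖ψ n w‖) ^ 2 := by gcongr
        _ ≤ _ := by nlinarith [sq_nonneg (‖ψ (n + 1) w‖ - R⁻¹ * ‖ψ n w‖)]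
    have h2 := integral_norm_sq_sub_const (μ := μ) (f := fun w => m n * φ 0 w)
      (continuous_const.mul (hφc 0)) (m (n + 1))
    have h3 : ∫ w, ‖m n * φ 0 w - ∫ v, m n * φ 0 v ∂μ‖ ^ 2 ∂μ = ‖m n‖ ^ 2 * V := by
      rw [hV, ← integral_const_mul (‖m n‖ ^ 2)]
      refine integral_congr_ae (Eventually.of_forall fun w => ?_)
      change ‖m n * φ 0 w - _‖ ^ 2 = ‖m n‖ ^ 2 * ‖φ 0 w - m 0‖ ^ 2
      rw [integral_const_mul (m n), ← mul_sub, norm_mul, mul_pow]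
    rw [h3] at h2
    have c1 : Continuous fun w => ‖ψ (n + 1) w‖ ^ 2 := (hψc _).norm.pow 2
    have c2 : Continuous fun w => ‖ψ n w‖ ^ 2 := (hψc _).norm.pow 2
    calc ‖m n‖ ^ 2 * V ≤ ∫ w, ‖m n * φ 0 w - m (n + 1)‖ ^ 2 ∂μ := by
          rw [h2]; exact le_add_of_nonneg_right (by positivity)
      _ ≤ ∫ w, (2 * ‖ψ (n + 1) w‖ ^ 2 + 2 * (R⁻¹ ^ 2 * ‖ψ n w‖ ^ 2)) ∂μ := by
          have := hφc 0
          exact integral_mono (hi (by fun_prop)) (hi (by fun_prop)) h1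
      _ = 2 * ∫ w, ‖ψ (n + 1) w‖ ^ 2 ∂μ + 2 * (R⁻¹ ^ 2 * ∫ w, ‖ψ n w‖ ^ 2 ∂μ) := by
          rw [integral_add (hi (by fun_prop)) (hi (by fun_prop)), integral_const_mul,
            integral_const_mul, integral_const_mul]
      _ ≤ _ := by gcongr <;> exact hvar _
  have hK : Nonempty K := μ.nonempty_of_neZero
  have hR' : 0 < R' := by
    obtain ⟨w⟩ := hK
    exact hR.trans_le ((hKR w w.2).1.trans (hKR w w.2).2)
  have hlow : ∀ n, (R' ^ 2)⁻¹ ^ (n + 1) ≤ A * ((R * T) ^ n)⁻¹ + ‖m n‖ ^ 2 := by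
    intro n
    have h1 := integral_norm_sq_sub_const (μ := μ) (hφc n) 0
    simp only [sub_zero] at h1
    calc (R' ^ 2)⁻¹ ^ (n + 1) = ∫ w : K, (R' ^ 2)⁻¹ ^ (n + 1) ∂μ := by simp
      _ ≤ ∫ w, ‖φ n w‖ ^ 2 ∂μ := by
          refine integral_mono (integrable_const _) (hi ((hφc n).norm.pow 2)) fun w => ?_
          simp only [hφ, norm_inv, norm_pow]
          rw [inv_pow, ← pow_mul, inv_pow, ← pow_mul, mul_comm 2 (n + 1)]
          have := hKR w w.2
          have : 0 < ‖(w : ℂ) - q‖ := by linarith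
          gcongr
          exact (hKR w w.2).2
      _ ≤ _ := by rw [h1]; gcongr; exact hvar n
  set σ := R' ^ 2 / (R * T) with hσ
  have hRT0 : 0 < R * T := by positivity
  have hσ0 : 0 ≤ σ := by positivity
  have hσ1 : σ < 1 := (div_lt_one hRT0).2 hRT
  set B := R' ^ 2 * (2 * (A * (R * T)⁻¹) + 2 * (R⁻¹ ^ 2 * A) + A * V) with hB
  have hVle : ∀ n, V ≤ B * σ ^ n := by
    intro n
    have h1 := mul_le_mul_of_nonneg_right (hlow n) hV0
    have h2 : (R' ^ 2)⁻¹ ^ (n + 1) * V ≤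
        (2 * (A * (R * T)⁻¹) + 2 * (R⁻¹ ^ 2 * A) + A * V) * ((R * T) ^ n)⁻¹ := by
      calc _ ≤ _ := h1
        _ = A * ((R * T) ^ n)⁻¹ * V + ‖m n‖ ^ 2 * V := by ring
        _ ≤ A * ((R * T) ^ n)⁻¹ * V + (2 * (A * ((R * T) ^ (n + 1))⁻¹) +
            2 * (R⁻¹ ^ 2 * (A * ((R * T) ^ n)⁻¹))) := by gcongr; exact hrec n
        _ = _ := by rw [pow_succ (R * T), mul_inv]; ring
    rw [inv_pow, inv_mul_le_iff₀ (by positivity)] at h2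
    calc V ≤ _ := h2
      _ = B * σ ^ n := by rw [hB, hσ, div_pow, pow_succ]; ring
  have hV' : V ≤ 0 := by
    have := (tendsto_pow_atTop_nhds_zero_of_lt_one hσ0 hσ1).const_mul B
    rw [mul_zero] at this
    exact ge_of_tendsto' this hVle
  have hz := (integral_eq_zero_iff_of_nonneg (fun w => sq_nonneg ‖ψ 0 w‖)
    (hi ((hψc 0).norm.pow 2))).1 (le_antisymm hV' hV0)
  filter_upwards [hz] with w hw
  simpa [hψ, sub_eq_zero] using hw

end Moments

lemma false_of_extension {D K : Set ℂ} [CompactSpace K] {μ : Measure K} [IsProbabilityMeasure μ]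
    (hD : IsOpen D) (hKD : Disjoint K D) {M : ℝ} (hM : ∀ ε > 0, ∀ z, logPot ε μ z ≤ M)
    {q : ℂ} {R R' T : ℝ} (hR : 0 < R) (hT : 0 < T) (hRT : R' ^ 2 < R * T)
    (hKR' : ∀ w ∈ K, ‖w - q‖ ≤ R') (hRD : ball q R ⊆ D)
    (hext : ∀ f ∈ L2h D, ∃ g, DifferentiableOn ℂ g (closedBall q T) ∧ EqOn g f (ball q R)) :
    False := by
  have hKR : ∀ w ∈ K, R ≤ ‖w - q‖ ∧ ‖w - q‖ ≤ R' := fun w hw => by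
    refine ⟨?_, hKR' w hw⟩
    by_contra! h
    exact disjoint_left.1 hKD hw (hRD (by rwa [mem_ball, dist_eq_norm]))
  set φ : ℕ → K → ℂ := fun (n : ℕ) (w : K) => (((w : ℂ) - q) ^ (n + 1))⁻¹ with hφ
  have hw0 : ∀ w : K, (w : ℂ) - q ≠ 0 := fun w =>
    norm_pos_iff.1 (hR.trans_le (hKR w w.2).1)
  have hφc : ∀ n, Continuous (φ n) := fun n =>
    Continuous.inv₀ (by fun_prop) fun w => pow_ne_zero _ (hw0 w)
  have hK : K ⊆ ball q (max R' 0 + 1) := fun w hw => by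
    rw [mem_ball, dist_eq_norm]
    linarith [hKR' w hw, le_max_left R' 0]
  obtain ⟨C, hC0, hC⟩ := exists_moment_bound (μ := μ) (T := T)
    (ψ := fun n w => φ n w - ∫ v, φ n v ∂μ) (fun n => (hφc n).sub continuous_const)
    (fun f => by
      have hfi := continuous_integrable_of_compactSpace μ f.continuous
      set h : K → ℂ := fun w => f w - ∫ v, f v ∂μ with hh
      have hhc : Continuous h := f.continuous.sub continuous_const
      have hhi := continuous_integrable_of_compactSpace μ hhc
      have h0 : ∫ w, h w ∂μ = 0 := by
        simp only [hh]
        rw [integral_sub hfi (integrable_const _)]; simp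
      obtain ⟨g, hg, hgF⟩ := hext _ (cauchyIntegral_mem_L2h hD hKD
        (by linarith [le_max_right R' 0]) hK hM hhc h0)
      obtain ⟨C, hC⟩ := (isCompact_sphere q T).exists_bound_of_continuousOn
        (hg.continuousOn.mono sphere_subset_closedBall)
      refine ⟨C, fun n => ?_⟩
      have h1 := Complex.norm_iteratedDeriv_le_of_forall_mem_sphere_norm_le n hT
        (hg.diffContOnCl_ball subset_rfl) hC
      have h2 := iteratedDeriv_cauchyIntegral hhi measurable_subtype_coe isOpen_ball
        (fun z hz => by
          obtain ⟨δ, hδ, hd⟩ := exists_forall_le_norm_sub (disjoint_right.1 hKD (hRD hz))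
          exact ⟨δ, hδ, Eventually.of_forall fun w => Or.inr (hd w w.2)⟩) n (mem_ball_self hR)
      have h3 := (hgF.eventuallyEq_of_mem (ball_mem_nhds q hR)).iteratedDeriv_eq n
      have h4 : ∫ w, f w * (φ n w - ∫ v, φ n v ∂μ) ∂μ = ∫ w, h w * φ n w ∂μ := by
        simp only [hh, mul_sub, sub_mul]
        have hp : Integrable (fun w => f w * φ n w) μ :=
          continuous_integrable_of_compactSpace μ (f.continuous.mul (hφc n))
        rw [integral_sub hp (hfi.mul_const _), integral_sub hp
          ((continuous_integrable_of_compactSpace μ (hφc n)).const_mul _), integral_mul_const,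
          integral_const_mul]
      rw [h4]
      rw [h3, h2] at h1
      change ‖(n.factorial : ℂ) * ∫ w, h w * φ n w ∂μ‖ ≤ _ at h1
      rw [norm_mul, Complex.norm_natCast, mul_div_assoc] at h1
      have h5 := le_of_mul_le_mul_left h1 (by positivity)
      rwa [le_div_iff₀ (by positivity), mul_comm] at h5) hT.le
  have hae := ae_eq_const_of_moment_bound (μ := μ) hR hT hRT hKR hφ hC0 hC
  obtain ⟨w₀, hw₀⟩ := hae.exists
  have hae' : ∀ᵐ w : K ∂μ, (w : ℂ) = w₀ := by
    filter_upwards [hae] with w hw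
    have : φ 0 w = φ 0 w₀ := hw.trans hw₀.symm
    simpa [hφ] using this
  have h1 : ∀ ε > 0, logPot ε μ w₀ = -Real.log ε := fun ε hε => by
    unfold logPot
    have : ∀ᵐ w : K ∂μ, logKer ε w₀ w = -Real.log ε := by
      filter_upwards [hae'] with w hw
      rw [hw, logKer, sub_self, norm_zero, zero_pow two_ne_zero, zero_add, Real.log_pow]
      push_cast; ring
    rw [integral_congr_ae this]
    simp
  have h2 := hM (Real.exp (-(M + 1))) (Real.exp_pos _) w₀
  rw [h1 _ (Real.exp_pos _), Real.log_exp] at h2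
  linarith

lemma PolarSet.mono {E F : Set ℂ} (h : PolarSet F) (hEF : E ⊆ F) : PolarSet E := by
  obtain ⟨Ω, hΩ, u, hu, hb⟩ := h
  exact ⟨Ω, hEF.trans hΩ, u, hu, fun z hz => hb z (hEF hz)⟩

/-- If functions on `D` extend from `D₀` to `D₁ ⊄ D`, they extend from a disc `ball q R ⊆ D`
touching the complement of `D` to a larger concentric disc. -/
lemma exists_disc_extension {D D₀ D₁ : Set ℂ} (hD : IsOpen D) (hD₀ : IsOpen D₀)
    (hD₀c : IsConnected D₀) (hD₁ : IsOpen D₁) (hD₁c : IsConnected D₁) (hsub : D₀ ⊆ D₁ ∩ D)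
    (hnot : ¬ D₁ ⊆ D) :
    ∃ (q p : ℂ) (R T : ℝ), 0 < R ∧ R < T ∧ dist q p = R ∧ p ∉ D ∧ ball q R ⊆ D ∧
      ∀ f g : ℂ → ℂ, DifferentiableOn ℂ f D → DifferentiableOn ℂ g D₁ → EqOn g f D₀ →
        DifferentiableOn ℂ g (closedBall q T) ∧ EqOn g f (ball q R) := by
  obtain ⟨x₀, hx₀⟩ := hD₀c.nonempty
  set C := connectedComponentIn (D₁ ∩ D) x₀ with hC
  have hCo : IsOpen C := (hD₁.inter hD).connectedComponentIn
  have hCsub : C ⊆ D₁ ∩ D := connectedComponentIn_subset _ _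
  have hD₀C : D₀ ⊆ C := hD₀c.isPreconnected.subset_connectedComponentIn hx₀ hsub
  obtain ⟨a, haC, haD₁, ha⟩ : ∃ a ∈ closure C, a ∈ D₁ ∧ a ∉ C := by
    by_contra! hcon
    refine hnot (fun z hz => (hCsub ?_).2)
    exact hD₁c.isPreconnected.subset_of_closure_inter_subset hCo ⟨x₀, (hsub hx₀).1, hD₀C hx₀⟩
      (fun z hz => hcon z hz.1 hz.2) hz
  have hball : ∀ z r, (ball z r ∩ C).Nonempty → ball z r ⊆ D₁ ∩ D → ball z r ⊆ C := by
    rintro z r ⟨y, hy, hyC⟩ hs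
    rw [hC, connectedComponentIn_eq hyC]
    exact (convex_ball z r).isPreconnected.subset_connectedComponentIn hy hs
  have haD : a ∉ D := fun haD => by
    obtain ⟨t, ht, h⟩ := Metric.isOpen_iff.1 (hD₁.inter hD) a ⟨haD₁, haD⟩
    obtain ⟨y, hyC, hy⟩ := Metric.mem_closure_iff.1 haC t ht
    exact ha (hball a t ⟨y, by rwa [mem_ball'], hyC⟩ h (mem_ball_self ht))
  obtain ⟨t, ht, htD₁⟩ := Metric.isOpen_iff.1 hD₁ a haD₁
  obtain ⟨q, hqC, hq⟩ := Metric.mem_closure_iff.1 haC (t / 4) (by positivity)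
  obtain ⟨p, hpD, hp⟩ := hD.isClosed_compl.exists_infDist_eq_dist ⟨a, haD⟩ q
  set R := infDist q Dᶜ with hRdef
  have hR : 0 < R := (hD.isClosed_compl.notMem_iff_infDist_pos ⟨a, haD⟩).1
    (notMem_compl_iff.2 (hCsub hqC).2)
  have hRa : R ≤ dist q a := infDist_le_dist_of_mem haD
  rw [dist_comm] at hq
  have hRD : ball q R ⊆ D := ball_infDist_compl_subset
  have hcb : closedBall q (t / 2) ⊆ D₁ := fun z hz => htD₁ (by
    rw [mem_ball]; rw [mem_closedBall] at hz
    linarith [dist_triangle z q a])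
  have hRC : ball q R ⊆ C := hball q R ⟨q, mem_ball_self hR, hqC⟩ fun z hz =>
    ⟨hcb (ball_subset_closedBall (ball_subset_ball (by linarith) hz)), hRD hz⟩
  refine ⟨q, p, R, t / 2, hR, by linarith, hp.symm, hpD, hRD, fun f g hf hg hfg =>
    ⟨hg.mono hcb, EqOn.mono hRC ?_⟩⟩
  exact ((hg.mono fun z hz => (hCsub hz).1).analyticOnNhd hCo).eqOn_of_preconnected_of_eventuallyEq
    ((hf.mono fun z hz => (hCsub hz).2).analyticOnNhd hCo) isPreconnected_connectedComponentIn
    (hD₀C hx₀) (hfg.eventuallyEq_of_mem (hD₀.mem_nhds hx₀))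

theorem isL2hDomainOfHolomorphy_of_not_polarSet {D : Set ℂ} (hD : IsOpen D)
    (h : ∀ U : Set ℂ, IsOpen U → (U \ D).Nonempty → ¬ PolarSet (U \ D)) :
    IsL2hDomainOfHolomorphy D := by
  rintro ⟨D₀, D₁, hD₀, hD₀c, hD₁, hD₁c, hsub, hnot, hext⟩
  obtain ⟨q, p, R, T, hR, hRT, hqp, hpD, hRD, hdisc⟩ :=
    exists_disc_extension hD hD₀ hD₀c hD₁ hD₁c hsub hnot
  obtain ⟨ε, hε, hεT⟩ : ∃ ε > 0, (R + ε) ^ 2 < R * T := by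
    have hc : Tendsto (fun ε : ℝ => (R + ε) ^ 2) (nhds 0) (nhds (R ^ 2)) :=
      (by fun_prop : Continuous fun ε : ℝ => (R + ε) ^ 2).tendsto' _ _ (by simp)
    have hev := hc.eventually_lt_const (by nlinarith : R ^ 2 < R * T)
    obtain ⟨ε, hε, hεpos⟩ := ((hev.filter_mono nhdsWithin_le_nhds).and
      (self_mem_nhdsWithin (s := Ioi (0 : ℝ)))).exists
    exact ⟨ε, hεpos, hε⟩
  set K := closedBall p ε \ D with hK
  have : CompactSpace K := isCompact_iff_compactSpace.1 ((isCompact_closedBall p ε).diff hD)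
  have : Nonempty K := ⟨⟨p, mem_closedBall_self hε.le, hpD⟩⟩
  rcases bounded_potential_or_large (K := K) with ⟨μ, M, hM⟩ | hlarge
  · refine false_of_extension (μ := (μ : Measure K)) hD disjoint_sdiff_left hM hR (hR.trans hRT)
      hεT (fun w hw => ?_) hRD fun f hf => ?_
    · have h1 := mem_closedBall.1 hw.1
      rw [← dist_eq_norm]
      linarith [dist_triangle w p q, dist_comm p q]
    · obtain ⟨g, hg, hgf⟩ := hext f hf
      exact ⟨g, hdisc f g hf.1 hg hgf⟩
  · refine h (ball p ε) isOpen_ball ⟨p, mem_ball_self hε, hpD⟩ (PolarSet.mono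
      (polarSet_of_large (K := K) hε sdiff_subset fun V₀ => ?_)
      (sdiff_subset_sdiff_left ball_subset_closedBall))
    obtain ⟨δ, hδ, μ, V, hV, hlow, -⟩ := hlarge V₀
    exact ⟨δ, hδ, μ, fun a ha => hV.trans (hlow a ha)⟩

/-- A domain `D ⊆ ℂ` is an `L²ₕ`-domain of holomorphy iff `U \ D` is
not polar for every open `U` with `U \ D ≠ ∅`. -/
theorem planar_L2h_domain_iff (D : Set ℂ) (hDopen : IsOpen D) (hDconn : IsConnected D) :
    IsL2hDomainOfHolomorphy D ↔
      ∀ U : Set ℂ, IsOpen U → (U \ D).Nonempty → ¬ PolarSet (U \ D) := by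
  exact ⟨fun h U hU hne => h.not_polarSet hDopen hU hne,
    isL2hDomainOfHolomorphy_of_not_polarSet hDopen⟩
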